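/- arXiv:1702.05760 — 2 statements merged into one kernel-verified Lean document; each statement's English description precedes it below -/
import Mathlib

section
/- Fix θ ∈ (0, arccos(2/π)] (i.e. cos θ ≥ 2/π with θ > 0), and define h₋(β) = √(β² − 1) / ( (cos θ + β)·arccos(1/β) ) for β ∈ (1, ∞). Then h₋ is strictly increasing on (1, ∞), h₋(β) → 2/π as β → ∞, and consequently sup_{β > 1} h₋(β) = 2/π, the supremum not being attained. -/
open Real Filter

theorem aux_sin {x y : ℝ} (hx : 0 < x) (hxy : x < y) (hy : y ≤ π / 2) :
    x * sin y < y * sin x := by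
  have h := strictConcaveOn_sin_Icc.slope_anti_adjacent (x := 0) (y := x) (z := y)
    ⟨le_rfl, pi_pos.le⟩ ⟨by linarith, by linarith [pi_pos]⟩ hx hxy
  rw [sin_zero, sub_zero, sub_zero, div_lt_div_iff₀ (by linarith) hx] at h
  nlinarith

theorem aux_deriv (c x : ℝ) :
    HasDerivAt (fun t => t * cos t - sin t + c * (t - sin t * cos t))
      (sin x * (2 * c * sin x - x)) x := by
  have h := (((hasDerivAt_id x).mul (hasDerivAt_cos x)).sub (hasDerivAt_sin x)).add
    (((hasDerivAt_id x).sub ((hasDerivAt_sin x).mul (hasDerivAt_cos x))).const_mul c)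
  refine HasDerivAt.congr_deriv (f := fun t => t * cos t - sin t + c * (t - sin t * cos t)) h ?_
  simp only [id]
  linear_combination (-c) * (sin_sq_add_cos_sq x)

theorem aux_F {c s : ℝ} (hc : 2 / π ≤ c) (hs : 0 < s) (hs2 : s < π / 2) :
    0 < s * cos s - sin s + c * (s - sin s * cos s) := by
  have hcont : Continuous (fun t => t * cos t - sin t + c * (t - sin t * cos t)) := by fun_prop
  rcases le_or_gt 0 (2 * c * sin s - s) with h | h
  · have hm : StrictMonoOn (fun t => t * cos t - sin t + c * (t - sin t * cos t))
        (Set.Icc 0 s) := by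
      apply strictMonoOn_of_deriv_pos (convex_Icc _ _) hcont.continuousOn
      intro x hx
      rw [interior_Icc] at hx
      rw [(aux_deriv c x).deriv]
      have h1 := aux_sin hx.1 hx.2 hs2.le
      have hsx : 0 < sin x := sin_pos_of_pos_of_lt_pi hx.1 (by linarith [hx.2])
      have hc0 : 0 < c := lt_of_lt_of_le (by positivity) hc
      apply mul_pos hsx
      have : 0 < s * (2 * c * sin x - x) := by nlinarith [hx.1]
      exact pos_of_mul_pos_right this hs.le
    have := hm ⟨le_rfl, hs.le⟩ ⟨hs.le, le_rfl⟩ hs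
    simpa using this
  · have hm : StrictAntiOn (fun t => t * cos t - sin t + c * (t - sin t * cos t))
        (Set.Icc s (π / 2)) := by
      apply strictAntiOn_of_deriv_neg (convex_Icc _ _) hcont.continuousOn
      intro x hx
      rw [interior_Icc] at hx
      rw [(aux_deriv c x).deriv]
      have h1 := aux_sin hs hx.1 hx.2.le
      have hx0 : 0 < x := hs.trans hx.1
      have hsx : 0 < sin x := sin_pos_of_pos_of_lt_pi hx0 (by linarith [hx.2])
      have hc0 : 0 < c := lt_of_lt_of_le (by positivity) hc
      apply mul_neg_of_pos_of_neg hsx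
      have : 0 < s * (x - 2 * c * sin x) := by nlinarith
      linarith [pos_of_mul_pos_right this hs.le]
    have := hm ⟨le_rfl, hs2.le⟩ ⟨hs2.le, le_rfl⟩ hs2
    simp only [cos_pi_div_two, sin_pi_div_two] at this
    rw [div_le_iff₀ pi_pos] at hc
    linarith

theorem aux_k {c : ℝ} (hc : 2 / π ≤ c) :
    StrictMonoOn (fun t => sin t / (t * (1 + c * cos t))) (Set.Ioo 0 (π / 2)) := by
  have hc0 : 0 < c := lt_of_lt_of_le (by positivity) hc
  have key : ∀ x ∈ Set.Ioo 0 (π / 2), 0 < x * (1 + c * cos x) := by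
    intro x hx
    have : 0 < cos x := cos_pos_of_mem_Ioo ⟨by linarith [hx.1, pi_pos], hx.2⟩
    have := hx.1
    positivity
  apply strictMonoOn_of_deriv_pos (convex_Ioo _ _)
  · apply ContinuousOn.div (by fun_prop) (by fun_prop)
    intro x hx
    exact (key x hx).ne'
  · intro x hx
    rw [interior_Ioo] at hx
    have hd := (hasDerivAt_sin x).div ((hasDerivAt_id x).mul
      (((hasDerivAt_cos x).const_mul c).const_add 1)) (key x hx).ne'
    have hd' : deriv (fun t => sin t / (t * (1 + c * cos t))) x = _ := hd.deriv
    rw [hd']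
    have hk := key x hx
    apply div_pos _ (by simpa using pow_pos hk 2)
    have := aux_F hc hx.1 hx.2
    simp only [id, Pi.mul_apply]
    have e := sin_sq_add_cos_sq x
    have : cos x * (x * (1 + c * cos x)) - sin x * (1 * (1 + c * cos x) + x * (c * -sin x))
      = x * cos x - sin x + c * (x - sin x * cos x) := by
      linear_combination c * x * e
    linarith

theorem hminus_strictMono_sup (θ : ℝ) (hθ : θ ∈ Set.Ioc 0 (Real.arccos (2 / π))) :
    StrictMonoOn
        (fun β : ℝ =>
          Real.sqrt (β ^ 2 - 1) / ((Real.cos θ + β) * Real.arccos (1 / β)))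
        (Set.Ioi 1) ∧
    Tendsto
        (fun β : ℝ =>
          Real.sqrt (β ^ 2 - 1) / ((Real.cos θ + β) * Real.arccos (1 / β)))
        atTop (nhds (2 / π)) ∧
    IsLUB
        ((fun β : ℝ =>
          Real.sqrt (β ^ 2 - 1) / ((Real.cos θ + β) * Real.arccos (1 / β)))
            '' Set.Ioi 1) (2 / π) ∧
    (2 / π) ∉
        (fun β : ℝ =>
          Real.sqrt (β ^ 2 - 1) / ((Real.cos θ + β) * Real.arccos (1 / β)))
            '' Set.Ioi 1 := by
  have hc : 2 / π ≤ cos θ := by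
    have h := cos_le_cos_of_nonneg_of_le_pi hθ.1.le (arccos_le_pi _) hθ.2
    rwa [cos_arccos (by linarith [show 0 < 2 / π by positivity])
      (by rw [div_le_one pi_pos]; linarith [pi_gt_three])] at h
  set c := cos θ with hcdef
  set f := (fun β : ℝ => Real.sqrt (β ^ 2 - 1) / ((c + β) * Real.arccos (1 / β))) with hf
  have heq : ∀ β ∈ Set.Ioi (1:ℝ),
      f β = (fun t => sin t / (t * (1 + c * cos t))) (arccos (1 / β)) := by
    intro β hβ
    have hβ : 1 < β := hβ
    have hb0 : 0 < β := by linarith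
    have h1 : 1 / β ≤ 1 := by rw [div_le_one hb0]; exact hβ.le
    have h0 : 0 < 1 / β := by positivity
    simp only [hf]
    rw [sin_arccos, cos_arccos (by linarith) h1]
    have : β ^ 2 - 1 = β ^ 2 * (1 - (1 / β) ^ 2) := by field_simp
    rw [this, sqrt_mul (by positivity), sqrt_sq hb0.le]
    have e : (c + β) * arccos (1 / β) = β * (arccos (1 / β) * (1 + c * (1 / β))) := by
      field_simp
      ring
    rw [e, mul_div_mul_left _ _ hb0.ne']
  have hmem : ∀ β ∈ Set.Ioi (1:ℝ), arccos (1 / β) ∈ Set.Ioo 0 (π / 2) := by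
    intro β hβ
    have hβ : 1 < β := hβ
    have hb0 : 0 < β := by linarith
    exact ⟨arccos_pos.2 (by rw [div_lt_one hb0]; exact hβ),
      arccos_lt_pi_div_two.2 (by positivity)⟩
  have hmono : StrictMonoOn f (Set.Ioi 1) := by
    intro a ha b hb hab
    rw [heq a ha, heq b hb]
    apply aux_k hc (hmem a ha) (hmem b hb)
    have ha' : 1 < a := ha
    have hb' : 1 < b := hb
    have ha0 : 0 < a := by linarith
    have hb0 : 0 < b := by linarith
    apply strictAntiOn_arccos
    · exact ⟨by linarith [show 0 < 1 / b by positivity], by rw [div_le_one hb0]; exact hb'.le⟩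
    · exact ⟨by linarith [show 0 < 1 / a by positivity], by rw [div_le_one ha0]; exact ha'.le⟩
    · exact one_div_lt_one_div_of_lt ha0 hab
  have hlim : Tendsto f atTop (nhds (2 / π)) := by
    have h1 : Tendsto (fun β : ℝ => arccos (1 / β)) atTop (nhds (π / 2)) := by
      have h2 : Tendsto (fun β : ℝ => 1 / β) atTop (nhds 0) := by
        simpa using tendsto_inv_atTop_zero (𝕜 := ℝ)
      have := (continuous_arccos.tendsto 0).comp h2
      rwa [arccos_zero] at this
    have h3 : ContinuousAt (fun t => sin t / (t * (1 + c * cos t))) (π / 2) := by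
      apply ContinuousAt.div (by fun_prop) (by fun_prop)
      simp [pi_ne_zero]
    have h4 := h3.tendsto.comp h1
    have h5 : sin (π / 2) / (π / 2 * (1 + c * cos (π / 2))) = 2 / π := by
      simp
    rw [h5] at h4
    refine h4.congr' ?_
    filter_upwards [eventually_gt_atTop 1] with β hβ
    exact (heq β hβ).symm
  have hlt : ∀ β ∈ Set.Ioi (1:ℝ), f β < 2 / π := by
    intro β hβ
    have hβ' : 1 < β := hβ
    have hβ1 : β + 1 ∈ Set.Ioi (1:ℝ) := by
      show 1 < β + 1
      linarith
    refine (hmono hβ hβ1 (by linarith)).trans_le ?_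
    apply ge_of_tendsto hlim
    filter_upwards [eventually_ge_atTop (β + 1)] with b hb
    exact hmono.monotoneOn hβ1 (lt_of_lt_of_le hβ1 hb) hb
  refine ⟨hmono, hlim, ⟨?_, ?_⟩, ?_⟩
  · rintro _ ⟨β, hβ, rfl⟩
    exact (hlt β hβ).le
  · intro u hu
    apply le_of_tendsto hlim
    filter_upwards [eventually_gt_atTop 1] with b hb
    exact hu ⟨b, hb, rfl⟩
  · rintro ⟨β, hβ, h⟩
    exact (hlt β hβ).ne h
end

section
/- Let L(θ) = lim_{d→∞} (1/d)·ln p_d(θ) denote the limiting exponent of the hypercube-LSH collision probability (which exists for θ ∈ (0, π/2)). Then there exist constants C > 0 and ε₀ > 0 such that for all ε ∈ (0, ε₀), | L(arccos(1 − ε)) + (√2/π)·√ε | ≤ C·ε; in other words, for cos θ = 1 − ε with ε → 0⁺, p_d(θ) = (1 − (√2/π)√ε + O(ε))^{d + o(d)}. -/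
open MeasureTheory Real Filter

noncomputable section

instance (d : ℕ) : MeasurableSpace (Matrix (Fin d) (Fin d) ℝ) := MeasurableSpace.pi

/-- The sign function: `+1` if `t ≥ 0` and `-1` if `t < 0`. -/
def sgn (t : ℝ) : ℝ := if 0 ≤ t then 1 else -1

/-- The unit vector `x = e₁` in `ℝ^d`. -/
def xvec (d : ℕ) : Fin d → ℝ := fun i => if (i : ℕ) = 0 then 1 else 0

/-- The unit vector `y = (cos θ) e₁ + (sin θ) e₂` in `ℝ^d`. -/
def yvec (d : ℕ) (θ : ℝ) : Fin d → ℝ :=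
  fun i => if (i : ℕ) = 0 then Real.cos θ else if (i : ℕ) = 1 then Real.sin θ else 0

/-- The event that the hypercube hashes of `x` and `y` coincide:
`h_A(x) = h_A(y)` where `h_A(v) = (sgn((Av)₁), …, sgn((Av)_d))`. -/
def collisionEvent (d : ℕ) (θ : ℝ) : Set (Matrix.orthogonalGroup (Fin d) ℝ) :=
  {A | ∀ i : Fin d,
    sgn (((A : Matrix (Fin d) (Fin d) ℝ).mulVec (xvec d)) i)
      = sgn (((A : Matrix (Fin d) (Fin d) ℝ).mulVec (yvec d θ)) i)}

/-- The hypercube-LSH collision probability `p_d(θ)`, where `μ` is the Haar probability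
measure on the orthogonal group `O(d)`. -/
def collProb (d : ℕ) (θ : ℝ) (μ : Measure (Matrix.orthogonalGroup (Fin d) ℝ)) : ℝ :=
  (μ (collisionEvent d θ)).toReal

open ProbabilityTheory Matrix
open scoped ENNReal NNReal

abbrev OG (d : ℕ) := Matrix.orthogonalGroup (Fin d) ℝ

lemma meas_entry (d : ℕ) (i j : Fin d) :
    Measurable (fun A : OG d => (A : Matrix (Fin d) (Fin d) ℝ) i j) := by
  have h1 : Measurable (fun M : Matrix (Fin d) (Fin d) ℝ => M i j) :=
    (measurable_pi_apply j).comp (measurable_pi_apply i)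
  exact h1.comp measurable_subtype_coe

lemma meas_toOG {Ω : Type*} [MeasurableSpace Ω] (d : ℕ) (f : Ω → OG d)
    (h : ∀ i j, Measurable (fun w => (f w : Matrix (Fin d) (Fin d) ℝ) i j)) : Measurable f := by
  apply Measurable.subtype_mk
  exact measurable_pi_lambda _ fun i => measurable_pi_lambda _ fun j => h i j

lemma meas_divmul (d : ℕ) : Measurable (fun p : OG d × OG d => p.1⁻¹ * p.2) := by
  apply meas_toOG
  intro i j
  have : (fun w : OG d × OG d => ((w.1⁻¹ * w.2 : OG d) : Matrix (Fin d) (Fin d) ℝ) i j)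
      = fun w => ∑ k, (w.1 : Matrix (Fin d) (Fin d) ℝ) k i * (w.2 : Matrix (Fin d) (Fin d) ℝ) k j := by
    ext w
    rw [← Unitary.star_eq_inv]
    simp [Matrix.mul_apply, Matrix.star_apply]
  rw [this]
  refine Finset.measurable_sum _ fun k _ => ?_
  exact ((meas_entry d k i).comp measurable_fst).mul ((meas_entry d k j).comp measurable_snd)

lemma meas_mul_left (d : ℕ) (g : OG d) : Measurable (fun A : OG d => g * A) := by
  have := (meas_divmul d).comp (measurable_const.prodMk measurable_id : Measurable fun A : OG d => (g⁻¹, A))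
  simpa [Function.comp_def] using this

lemma meas_inv (d : ℕ) : Measurable (fun A : OG d => A⁻¹) := by
  have := (meas_divmul d).comp (measurable_id.prodMk measurable_const : Measurable fun A : OG d => (A, (1 : OG d)))
  simpa [Function.comp_def] using this

lemma meas_mul_right (d : ℕ) (g : OG d) : Measurable (fun A : OG d => A * g) := by
  have := (meas_divmul d).comp ((meas_inv d).prodMk measurable_const : Measurable fun A : OG d => (A⁻¹, g))
  simpa [Function.comp_def] using this

lemma left_inv (d : ℕ) (μ : Measure (OG d)) [μ.IsHaarMeasure] (g : OG d) {E : Set (OG d)}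
    (hE : MeasurableSet E) : μ {A | g * A ∈ E} = μ E := by
  have h := map_mul_left_eq_self μ g
  have h2 : (Measure.map (fun A => g * A) μ) E = μ E := by rw [h]
  rwa [Measure.map_apply (meas_mul_left d g) hE] at h2

lemma inv_inv_meas (d : ℕ) (μ : Measure (OG d)) [μ.IsHaarMeasure] [IsProbabilityMeasure μ]
    {E : Set (OG d)} (hE : MeasurableSet E) : μ {A | A⁻¹ ∈ E} = μ E := by
  have hS : MeasurableSet {p : OG d × OG d | p.1⁻¹ * p.2 ∈ E} := meas_divmul d hE
  have h1 : (μ.prod μ) {p : OG d × OG d | p.1⁻¹ * p.2 ∈ E} = μ E := by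
    rw [Measure.prod_apply hS]
    have : ∀ A : OG d, μ (Prod.mk A ⁻¹' {p : OG d × OG d | p.1⁻¹ * p.2 ∈ E}) = μ E :=
      fun A => left_inv d μ A⁻¹ hE
    simp_rw [this]
    simp
  have h2 : (μ.prod μ) {p : OG d × OG d | p.1⁻¹ * p.2 ∈ E} = μ {A | A⁻¹ ∈ E} := by
    rw [Measure.prod_apply_symm hS]
    have : ∀ B : OG d, μ ((fun A => (A, B)) ⁻¹' {p : OG d × OG d | p.1⁻¹ * p.2 ∈ E})
        = μ {A | A⁻¹ ∈ E} := by
      intro B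
      have h := left_inv d μ B⁻¹ (E := {A | A⁻¹ ∈ E}) (meas_inv d hE)
      rw [← h]
      congr 1
      ext A
      simp
    simp_rw [this]
    simp
  rw [← h1, h2]

lemma right_inv (d : ℕ) (μ : Measure (OG d)) [μ.IsHaarMeasure] [IsProbabilityMeasure μ]
    (U : OG d) {E : Set (OG d)} (hE : MeasurableSet E) : μ {A | A * U ∈ E} = μ E := by
  rw [← inv_inv_meas d μ (E := {A | A * U ∈ E}) (meas_mul_right d U hE),
    ← inv_inv_meas d μ hE, ← left_inv d μ U⁻¹ (E := {A | A⁻¹ ∈ E}) (meas_inv d hE)]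
  congr 1
  ext A
  simp

lemma meas_sgn : Measurable sgn := by
  unfold sgn
  exact Measurable.ite measurableSet_Ici measurable_const measurable_const

lemma meas_mulVec (d : ℕ) (i : Fin d) :
    Measurable (fun p : OG d × (Fin d → ℝ) => ((p.1 : Matrix (Fin d) (Fin d) ℝ).mulVec p.2) i) := by
  simp only [Matrix.mulVec, dotProduct]
  refine Finset.measurable_sum _ fun k _ => ?_
  exact ((meas_entry d i k).comp measurable_fst).mul
    ((measurable_pi_apply k).comp measurable_snd)

lemma meas_agree (d : ℕ) (x y : Fin d → ℝ) : MeasurableSet {A : OG d |  ∀ i : Fin d,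
    sgn (((A : Matrix (Fin d) (Fin d) ℝ).mulVec x) i)
      = sgn (((A : Matrix (Fin d) (Fin d) ℝ).mulVec y) i)} := by
  rw [Set.ofPred_forall]
  refine MeasurableSet.iInter fun i => ?_
  exact measurableSet_eq_fun
    (meas_sgn.comp ((meas_mulVec d i).comp (measurable_id.prodMk measurable_const)))
    (meas_sgn.comp ((meas_mulVec d i).comp (measurable_id.prodMk measurable_const)))

def evec (d : ℕ) : Fin d → ℝ := fun i => if (i : ℕ) = 1 then 1 else 0

lemma yvec_eq (d : ℕ) (θ : ℝ) : yvec d θ = cos θ • xvec d + sin θ • evec d := by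
  ext i
  simp only [yvec, xvec, evec, Pi.add_apply, Pi.smul_apply, smul_eq_mul]
  by_cases h0 : (i : ℕ) = 0
  · simp [h0]
  · by_cases h1 : (i : ℕ) = 1 <;> simp [h0, h1]

lemma basis_to_OG (d : ℕ) (b : OrthonormalBasis (Fin d) ℝ (EuclideanSpace ℝ (Fin d))) :
    ∃ U : OG d, ∀ i j, (U : Matrix (Fin d) (Fin d) ℝ) i j = b j i := by
  refine ⟨⟨(EuclideanSpace.basisFun (Fin d) ℝ).toBasis.toMatrix b,
    (EuclideanSpace.basisFun (Fin d) ℝ).toMatrix_orthonormalBasis_mem_unitary b⟩, ?_⟩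
  intro i j
  simp [Module.Basis.toMatrix_apply]

lemma mulVec_xvec (d : ℕ) (hd : 2 ≤ d) (U : Matrix (Fin d) (Fin d) ℝ) :
    U.mulVec (xvec d) = fun i => U i ⟨0, by omega⟩ := by
  have : xvec d = Pi.single ⟨0, by omega⟩ 1 := by
    ext i; simp [xvec, Pi.single_apply, Fin.ext_iff]
  rw [this]; ext i; simp

lemma mulVec_evec (d : ℕ) (hd : 2 ≤ d) (U : Matrix (Fin d) (Fin d) ℝ) :
    U.mulVec (evec d) = fun i => U i ⟨1, by omega⟩ := by
  have : evec d = Pi.single ⟨1, by omega⟩ 1 := by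
    ext i; simp [evec, Pi.single_apply, Fin.ext_iff]
  rw [this]; ext i; simp

lemma OG_dot (d : ℕ) (U : OG d) (x y : Fin d → ℝ) :
    ((U : Matrix (Fin d) (Fin d) ℝ).mulVec x) ⬝ᵥ ((U : Matrix (Fin d) (Fin d) ℝ).mulVec y)
      = x ⬝ᵥ y := by
  have h := (Matrix.mem_orthogonalGroup_iff' (Fin d) ℝ).1 U.2
  rw [Matrix.dotProduct_mulVec, Matrix.vecMul_mulVec]
  have h' : (U : Matrix (Fin d) (Fin d) ℝ)ᵀ * (U : Matrix (Fin d) (Fin d) ℝ) = 1 := h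
  rw [h', Matrix.vecMul_one]

lemma frame (d : ℕ) (hd : 2 ≤ d) (X Y : Fin d → ℝ) (hX : X ≠ 0) :
    ∃ U : OG d, ∃ r a b : ℝ, 0 < r ∧ 0 ≤ b ∧
      X = r • (U : Matrix (Fin d) (Fin d) ℝ).mulVec (xvec d) ∧
      Y = (U : Matrix (Fin d) (Fin d) ℝ).mulVec (a • xvec d + b • evec d) := by
  set x : EuclideanSpace ℝ (Fin d) := WithLp.toLp 2 X with hx
  set y : EuclideanSpace ℝ (Fin d) := WithLp.toLp 2 Y with hy
  have hx0 : x ≠ 0 := by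
    intro h; apply hX; ext i
    have := congrArg (fun z : EuclideanSpace ℝ (Fin d) => z i) h
    simpa [hx] using this
  have hr : 0 < ‖x‖ := norm_pos_iff.2 hx0
  set u : EuclideanSpace ℝ (Fin d) := (‖x‖)⁻¹ • x with hu
  have hu1 : ‖u‖ = 1 := by rw [hu, norm_smul]; simp [hr.ne']
  set a : ℝ := inner ℝ u y
  set w : EuclideanSpace ℝ (Fin d) := y - a • u with hw
  have huw : inner ℝ u w = 0 := by
    rw [hw, inner_sub_right, inner_smul_right, real_inner_self_eq_norm_sq, hu1]; simp [a]
  have hxu : x = ‖x‖ • u := by rw [hu, smul_smul, mul_inv_cancel₀ hr.ne', one_smul]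
  have key : ∃ b : OrthonormalBasis (Fin d) ℝ (EuclideanSpace ℝ (Fin d)),
      b ⟨0, by omega⟩ = u ∧ w = ‖w‖ • b ⟨1, by omega⟩ := by
    by_cases hw0 : w = 0
    · have : Orthonormal ℝ (Set.domRestrict {(⟨0, by omega⟩ : Fin d)}
          (fun _ : Fin d => u)) := by
        constructor
        · intro i; simpa using hu1
        · intro i j hij; exact absurd (Subsingleton.elim i j) hij
      obtain ⟨b, hb⟩ := this.exists_orthonormalBasis_extension_of_card_eq (by simp)
      exact ⟨b, hb _ (by simp), by simp [hw0]⟩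
    · have hwn : 0 < ‖w‖ := norm_pos_iff.2 hw0
      set v : Fin d → EuclideanSpace ℝ (Fin d) :=
        fun i => if (i : ℕ) = 0 then u else (‖w‖)⁻¹ • w with hv
      have : Orthonormal ℝ (Set.domRestrict {(⟨0, by omega⟩ : Fin d), ⟨1, by omega⟩} v) := by
        constructor
        · rintro ⟨i, hi⟩
          simp only [Set.domRestrict_apply, hv]
          split_ifs
          · exact hu1
          · rw [norm_smul]; simp [hwn.ne']
        · rintro ⟨i, hi⟩ ⟨j, hj⟩ hij
          simp only [Set.domRestrict_apply, hv]
          have hwu : inner ℝ w u = 0 := by rw [real_inner_comm]; exact huw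
          rcases hi with rfl | rfl <;> rcases hj with rfl | rfl
          · exact absurd rfl hij
          · simp [inner_smul_right, huw]
          · simp [inner_smul_left, hwu]
          · exact absurd rfl hij
      obtain ⟨b, hb⟩ := this.exists_orthonormalBasis_extension_of_card_eq (by simp)
      refine ⟨b, by rw [hb _ (by simp)]; simp [hv], ?_⟩
      rw [hb _ (by simp)]; simp [hv, smul_smul, hwn.ne']
  obtain ⟨b, hb0, hb1⟩ := key
  obtain ⟨U, hU⟩ := basis_to_OG d b
  refine ⟨U, ‖x‖, a, ‖w‖, hr, norm_nonneg _, ?_, ?_⟩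
  · rw [mulVec_xvec d hd]
    ext i
    simp only [Pi.smul_apply, hU, hb0]
    have := congrArg (fun z : EuclideanSpace ℝ (Fin d) => z i) hxu
    simpa [hx] using this
  · rw [Matrix.mulVec_add, Matrix.mulVec_smul, Matrix.mulVec_smul, mulVec_xvec d hd,
      mulVec_evec d hd]
    ext i
    have h1 := congrArg (fun z : EuclideanSpace ℝ (Fin d) => z i) hb1
    have h2 : w i = Y i - a * u i := by simp [hw, hy]
    simp only [Pi.add_apply, Pi.smul_apply, hU, hb0]
    simp only [PiLp.smul_apply] at h1
    rw [← h1, h2]; simp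

lemma sgn_comb {p q l k : ℝ} (h : sgn p = sgn q) (hl : 0 ≤ l) (hk : 0 ≤ k) (hlk : 0 < l + k) :
    sgn p = sgn (l * p + k * q) := by
  unfold sgn at *
  by_cases hp : 0 ≤ p
  · have hq : 0 ≤ q := by
      by_contra hq; simp [hp, hq] at h; linarith
    rw [if_pos hp, if_pos (by positivity)]
  · have hq : ¬ 0 ≤ q := by
      intro hq; simp [hp, hq] at h; linarith
    rw [if_neg hp, if_neg]
    push Not at hp hq ⊢
    rcases hl.lt_or_eq with h1 | h1
    · nlinarith
    · subst h1; nlinarith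

lemma sgn_pos_mul {r t : ℝ} (hr : 0 < r) : sgn (r * t) = sgn t := by
  unfold sgn; simp [mul_nonneg_iff_of_pos_left hr]

def agreeSet (d : ℕ) (X Y : Fin d → ℝ) : Set (OG d) :=
  {A | ∀ i : Fin d, sgn (((A : Matrix (Fin d) (Fin d) ℝ).mulVec X) i)
      = sgn (((A : Matrix (Fin d) (Fin d) ℝ).mulVec Y) i)}

lemma coll_eq (d : ℕ) (θ : ℝ) : collisionEvent d θ = agreeSet d (xvec d) (yvec d θ) := rfl

lemma agree_frame (d : ℕ) (μ : Measure (OG d)) [μ.IsHaarMeasure] [IsProbabilityMeasure μ]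
    (U : OG d) (r : ℝ) (hr : 0 < r) (x y : Fin d → ℝ) :
    μ (agreeSet d (r • (U : Matrix (Fin d) (Fin d) ℝ).mulVec x)
      ((U : Matrix (Fin d) (Fin d) ℝ).mulVec y)) = μ (agreeSet d x y) := by
  rw [← right_inv d μ U (E := agreeSet d x y) (meas_agree d x y)]
  congr 1
  ext A
  simp only [agreeSet, Set.mem_ofPred_eq, Matrix.mulVec_smul, Matrix.mulVec_mulVec, Pi.smul_apply,
    smul_eq_mul, sgn_pos_mul hr, Submonoid.coe_mul]

lemma dot_frame (d : ℕ) (hd : 2 ≤ d) (a b a' b' : ℝ) :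
    (a • xvec d + b • evec d) ⬝ᵥ (a' • xvec d + b' • evec d) = a * a' + b * b' := by
  have h1 : xvec d = Pi.single ⟨0, by omega⟩ 1 := by
    ext i; simp [xvec, Pi.single_apply, Fin.ext_iff]
  have h2 : evec d = Pi.single ⟨1, by omega⟩ 1 := by
    ext i; simp [evec, Pi.single_apply, Fin.ext_iff]
  rw [h1, h2]; simp [dotProduct_add]; ring

lemma frame_dots (d : ℕ) (hd : 2 ≤ d) (U : OG d) (r a b : ℝ) (hr : 0 < r) (X Y : Fin d → ℝ)
    (hX : X = r • (U : Matrix (Fin d) (Fin d) ℝ).mulVec (xvec d))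
    (hY : Y = (U : Matrix (Fin d) (Fin d) ℝ).mulVec (a • xvec d + b • evec d)) :
    X ⬝ᵥ Y = r * a ∧ √(X ⬝ᵥ X) = r ∧ Y ⬝ᵥ Y = a ^ 2 + b ^ 2 := by
  have h0 : X = (U : Matrix (Fin d) (Fin d) ℝ).mulVec (r • xvec d + (0:ℝ) • evec d) := by
    rw [hX]; simp [Matrix.mulVec_smul]
  have e1 : X ⬝ᵥ Y = r * a := by rw [h0, hY, OG_dot, dot_frame d hd]; ring
  have e2 : X ⬝ᵥ X = r ^ 2 := by rw [h0, OG_dot, dot_frame d hd]; ring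
  have e3 : Y ⬝ᵥ Y = a ^ 2 + b ^ 2 := by rw [hY, OG_dot, dot_frame d hd]; ring
  exact ⟨e1, by rw [e2, Real.sqrt_sq hr.le], e3⟩

lemma key_lower (d : ℕ) (hd : 2 ≤ d) (μ : Measure (OG d)) [μ.IsHaarMeasure]
    [IsProbabilityMeasure μ] (θ : ℝ) (h0 : 0 < θ) (h1 : θ < π / 2) (X Y : Fin d → ℝ)
    (h : X ⬝ᵥ Y < cos θ * √(X ⬝ᵥ X) * √(Y ⬝ᵥ Y)) :
    μ (agreeSet d X Y) ≤ μ (collisionEvent d θ) := by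
  have hX0 : X ≠ 0 := by rintro rfl; simp at h
  obtain ⟨U, r, a, b, hr, hb, hX, hY⟩ := frame d hd X Y hX0
  obtain ⟨e1, e2, e3⟩ := frame_dots d hd U r a b hr X Y hX hY
  have hc : 0 < cos θ := cos_pos_of_mem_Ioo ⟨by linarith, h1⟩
  have hs : 0 < sin θ := sin_pos_of_pos_of_lt_pi h0 (by linarith)
  rw [e1, e2, e3] at h
  have h' : a < cos θ * √(a ^ 2 + b ^ 2) := by
    have : r * a < r * (cos θ * √(a ^ 2 + b ^ 2)) := by linarith
    exact lt_of_mul_lt_mul_left this hr.le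
  rw [hX, hY, agree_frame d μ U r hr, coll_eq, yvec_eq]
  apply measure_mono
  intro A hA i
  have hA' := hA i
  have hnz : 0 < b ∨ (b = 0 ∧ a < 0) := by
    rcases hb.lt_or_eq with hb | hb
    · exact Or.inl hb
    · right
      refine ⟨hb.symm, ?_⟩
      rw [← hb] at h'
      simp only [ne_eq, OfNat.ofNat_ne_zero, not_false_eq_true, zero_pow, add_zero,
        Real.sqrt_sq_eq_abs] at h'
      by_contra ha
      push Not at ha
      rw [abs_of_nonneg ha] at h'
      nlinarith [cos_le_one θ]
  rcases hnz with hb | ⟨hb, ha⟩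
  · have hab : a * sin θ ≤ b * cos θ := by
      by_contra hcon
      push Not at hcon
      have ha : 0 < a := by
        by_contra ha
        push Not at ha
        nlinarith [mul_pos hb hc, mul_nonneg (neg_nonneg.2 ha) hs.le]
      have hsq : (b * cos θ) ^ 2 < (a * sin θ) ^ 2 := by
        apply pow_lt_pow_left₀ hcon (by positivity) (by norm_num)
      have : (cos θ * √(a ^ 2 + b ^ 2)) ^ 2 < a ^ 2 := by
        rw [mul_pow, Real.sq_sqrt (by positivity)]
        nlinarith [sin_sq_add_cos_sq θ]
      have h3 := abs_lt_of_sq_lt_sq this ha.le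
      exact absurd (lt_of_le_of_lt (le_abs_self _) h3) (by linarith)
    have hcomb := sgn_comb (l := cos θ - a * sin θ / b) (k := sin θ / b) hA'
      (by rw [sub_nonneg, div_le_iff₀ hb]; linarith) (by positivity)
      (by
        have : 0 < sin θ / b := by positivity
        have : 0 ≤ cos θ - a * sin θ / b := by
          rw [sub_nonneg, div_le_iff₀ hb]; linarith
        linarith)
    rw [hcomb]
    congr 1
    simp only [Matrix.mulVec_add, Matrix.mulVec_smul, Pi.add_apply, Pi.smul_apply, smul_eq_mul]
    field_simp
    ring
  · exfalso
    have hz : (A : Matrix (Fin d) (Fin d) ℝ).mulVec (xvec d) = 0 := by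
      ext j
      have hj := hA j
      rw [hb] at hj
      simp only [Matrix.mulVec_add, Matrix.mulVec_smul, Pi.add_apply, Pi.smul_apply, smul_eq_mul,
        zero_mul, add_zero] at hj
      set t := (A : Matrix (Fin d) (Fin d) ℝ).mulVec (xvec d) j
      by_contra ht
      rcases lt_or_gt_of_ne ht with ht | ht
      · unfold sgn at hj
        have ht' : t < 0 := ht
        rw [if_neg (by linarith), if_pos (by nlinarith)] at hj
        linarith
      · unfold sgn at hj
        have ht' : 0 < t := ht
        rw [if_pos ht'.le, if_neg (by nlinarith)] at hj
        linarith
    have := OG_dot d A (xvec d) (xvec d)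
    rw [hz] at this
    have h2 := dot_frame d hd 1 0 1 0
    simp at h2 this
    rw [h2] at this
    norm_num at this

lemma key_upper (d : ℕ) (hd : 2 ≤ d) (μ : Measure (OG d)) [μ.IsHaarMeasure]
    [IsProbabilityMeasure μ] (θ : ℝ) (h0 : 0 < θ) (h1 : θ < π / 2) (X Y : Fin d → ℝ)
    (h : cos θ * √(X ⬝ᵥ X) * √(Y ⬝ᵥ Y) < X ⬝ᵥ Y) :
    μ (collisionEvent d θ) ≤ μ (agreeSet d X Y) := by
  have hX0 : X ≠ 0 := by rintro rfl; simp at h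
  obtain ⟨U, r, a, b, hr, hb, hX, hY⟩ := frame d hd X Y hX0
  obtain ⟨e1, e2, e3⟩ := frame_dots d hd U r a b hr X Y hX hY
  have hc : 0 < cos θ := cos_pos_of_mem_Ioo ⟨by linarith, h1⟩
  have hs : 0 < sin θ := sin_pos_of_pos_of_lt_pi h0 (by linarith)
  rw [e1, e2, e3] at h
  have h' : cos θ * √(a ^ 2 + b ^ 2) < a := by
    have : r * (cos θ * √(a ^ 2 + b ^ 2)) < r * a := by linarith
    exact lt_of_mul_lt_mul_left this hr.le
  rw [hX, hY, agree_frame d μ U r hr, coll_eq, yvec_eq]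
  apply measure_mono
  intro A hA i
  have hA' := hA i
  have ha : 0 < a := lt_of_le_of_lt (by positivity) h'
  have hab : b * cos θ < a * sin θ := by
    have hsq : (cos θ * √(a ^ 2 + b ^ 2)) ^ 2 < a ^ 2 :=
      pow_lt_pow_left₀ h' (by positivity) (by norm_num)
    rw [mul_pow, Real.sq_sqrt (by positivity)] at hsq
    apply lt_of_pow_lt_pow_left₀ 2 (by positivity)
    nlinarith [sin_sq_add_cos_sq θ]
  have hcomb := sgn_comb (l := a - b * cos θ / sin θ) (k := b / sin θ) hA'
      (by rw [sub_nonneg, div_le_iff₀ hs]; linarith) (by positivity)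
      (by
        have : 0 ≤ b / sin θ := by positivity
        have : 0 < a - b * cos θ / sin θ := by
          rw [sub_pos, div_lt_iff₀ hs]; linarith
        linarith)
  rw [hcomb]
  congr 1
  simp only [Matrix.mulVec_add, Matrix.mulVec_smul, Pi.add_apply, Pi.smul_apply, smul_eq_mul]
  field_simp
  ring

abbrev gm : Measure ℝ := gaussianReal 0 1
abbrev GD (d : ℕ) : Measure (Fin d → ℝ) := Measure.pi (fun _ : Fin d => gm)
abbrev g2 : Measure (ℝ × ℝ) := gm.prod gm
abbrev PD (d : ℕ) : Measure (Fin d → ℝ × ℝ) := Measure.pi (fun _ : Fin d => g2)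

lemma gauss_inv (d : ℕ) (A : OG d) :
    MeasurePreserving (fun x => (A : Matrix (Fin d) (Fin d) ℝ).mulVec x) (GD d) (GD d) := by
  have hm : Measurable (fun x : Fin d → ℝ => (A : Matrix (Fin d) (Fin d) ℝ).mulVec x) :=
    measurable_pi_lambda _ fun i => (meas_mulVec d i).comp (measurable_const.prodMk measurable_id)
  refine ⟨hm, ?_⟩
  let L : EuclideanSpace ℝ (Fin d) →ₗᵢ[ℝ] EuclideanSpace ℝ (Fin d) :=
    { toLinearMap := Matrix.toEuclideanLin (A : Matrix (Fin d) (Fin d) ℝ)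
      norm_map' := by
        intro x
        have h := OG_dot d A (WithLp.ofLp x) (WithLp.ofLp x)
        rw [EuclideanSpace.norm_eq, EuclideanSpace.norm_eq]
        congr 1
        simpa [dotProduct, sq] using h }
  let e := L.toLinearIsometryEquiv rfl
  have h1 := stdGaussian_map e
  rw [← map_pi_eq_stdGaussian, Measure.map_map (by fun_prop) (by fun_prop)] at h1
  have h2 := congrArg (Measure.map (WithLp.ofLp : EuclideanSpace ℝ (Fin d) → _)) h1
  rw [Measure.map_map (by fun_prop) (by fun_prop), Measure.map_map (by fun_prop) (by fun_prop)] at h2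
  have e1 : (WithLp.ofLp : EuclideanSpace ℝ (Fin d) → _) ∘ (WithLp.toLp 2) = id := rfl
  rw [e1, Measure.map_id] at h2
  exact h2

/-- second vector -/
def Yv (α : ℝ) (p : ℝ × ℝ) : ℝ := cos α * p.1 + sin α * p.2

lemma meas_Yv (α : ℝ) : Measurable (Yv α) := by unfold Yv; fun_prop

def YV (d : ℕ) (α : ℝ) (p : (Fin d → ℝ) × (Fin d → ℝ)) : Fin d → ℝ := cos α • p.1 + sin α • p.2

lemma meas_YV (d : ℕ) (α : ℝ) : Measurable (YV d α) := by unfold YV; fun_prop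

lemma fub (d : ℕ) (μ : Measure (OG d)) [IsProbabilityMeasure μ] (α : ℝ)
    (F : Set ((Fin d → ℝ) × (Fin d → ℝ))) (hF : MeasurableSet F)
    (hinv : ∀ (A : OG d) p, ((A : Matrix (Fin d) (Fin d) ℝ).mulVec p.1,
      (A : Matrix (Fin d) (Fin d) ℝ).mulVec p.2) ∈ F ↔ p ∈ F) :
    ((GD d).prod (GD d)) (F ∩ {p | ∀ i, sgn (p.1 i) = sgn (YV d α p i)})
      = ∫⁻ p in F, μ (agreeSet d p.1 (YV d α p)) ∂((GD d).prod (GD d)) := by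
  have hAg : MeasurableSet {p : (Fin d → ℝ) × (Fin d → ℝ) | ∀ i, sgn (p.1 i) = sgn (YV d α p i)} := by
    rw [Set.ofPred_forall]
    refine MeasurableSet.iInter fun i => ?_
    exact measurableSet_eq_fun
      (meas_sgn.comp ((measurable_pi_apply i).comp measurable_fst))
      (meas_sgn.comp ((measurable_pi_apply i).comp (meas_YV d α)))
  set W : Set (OG d × ((Fin d → ℝ) × (Fin d → ℝ))) :=
    {q | q.2 ∈ F ∧ q.1 ∈ agreeSet d q.2.1 (YV d α q.2)} with hW
  have hWm : MeasurableSet W := by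
    apply MeasurableSet.inter (measurable_snd hF)
    change MeasurableSet {q : OG d × ((Fin d → ℝ) × (Fin d → ℝ)) | ∀ i : Fin d, _ = _}
    rw [Set.ofPred_forall]
    refine MeasurableSet.iInter fun i => ?_
    exact measurableSet_eq_fun
      (meas_sgn.comp ((meas_mulVec d i).comp (measurable_fst.prodMk (measurable_fst.comp measurable_snd))))
      (meas_sgn.comp ((meas_mulVec d i).comp (measurable_fst.prodMk ((meas_YV d α).comp measurable_snd))))
  have h1 : (μ.prod ((GD d).prod (GD d))) W
      = ((GD d).prod (GD d)) (F ∩ {p | ∀ i, sgn (p.1 i) = sgn (YV d α p i)}) := by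
    rw [Measure.prod_apply hWm]
    have : ∀ A : OG d, ((GD d).prod (GD d)) (Prod.mk A ⁻¹' W)
        = ((GD d).prod (GD d)) (F ∩ {p | ∀ i, sgn (p.1 i) = sgn (YV d α p i)}) := by
      intro A
      have hp := (gauss_inv d A).prod (gauss_inv d A)
      rw [← hp.measure_preimage (hF.inter hAg).nullMeasurableSet]
      congr 1
      ext p
      have := hinv A p
      simp only [hW, Set.mem_preimage, Set.mem_ofPred_eq, Set.mem_inter_iff, Prod.map, this, agreeSet,
        YV, Matrix.mulVec_add, Matrix.mulVec_smul]
    simp_rw [this]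
    simp
  rw [← h1, Measure.prod_apply_symm hWm, ← lintegral_indicator hF]
  congr 1
  ext p
  by_cases hp : p ∈ F
  · rw [Set.indicator_of_mem hp]
    congr 1
    ext A
    simp [hW, hp]
  · rw [Set.indicator_of_notMem hp]
    have : (fun A : OG d => (A, p)) ⁻¹' W = ∅ := by
      ext A
      simp [hW, hp]
    rw [this]; simp

lemma fub_pi (d : ℕ) (μ : Measure (OG d)) [IsProbabilityMeasure μ] (_α : ℝ)
    (F : Set ((Fin d → ℝ) × (Fin d → ℝ))) (hF : MeasurableSet F) :
    ((GD d).prod (GD d)) F = PD d {z | (fun i => (z i).1, fun i => (z i).2) ∈ F} := by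
  have h := measurePreserving_arrowProdEquivProdArrow ℝ ℝ (Fin d) (fun _ => gm) (fun _ => gm)
  rw [← h.measure_preimage hF.nullMeasurableSet]
  rfl

lemma YV_inv (d : ℕ) (α : ℝ) (A : OG d) (p : (Fin d → ℝ) × (Fin d → ℝ)) :
    YV d α ((A : Matrix (Fin d) (Fin d) ℝ).mulVec p.1, (A : Matrix (Fin d) (Fin d) ℝ).mulVec p.2)
      = (A : Matrix (Fin d) (Fin d) ℝ).mulVec (YV d α p) := by
  simp [YV, Matrix.mulVec_add, Matrix.mulVec_smul]

lemma meas_dot (d : ℕ) {Ω : Type*} [MeasurableSpace Ω] (f g : Ω → Fin d → ℝ) (hf : Measurable f)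
    (hg : Measurable g) : Measurable (fun w => f w ⬝ᵥ g w) := by
  simp only [dotProduct]
  exact Finset.measurable_sum _ fun i _ =>
    ((measurable_pi_apply i).comp hf).mul ((measurable_pi_apply i).comp hg)

def SA (α : ℝ) : Set (ℝ × ℝ) := {p | sgn p.1 = sgn (Yv α p)}

lemma meas_SA (α : ℝ) : MeasurableSet (SA α) :=
  measurableSet_eq_fun (meas_sgn.comp measurable_fst) (meas_sgn.comp (meas_Yv α))

lemma lower_pi (d : ℕ) (hd : 2 ≤ d) (μ : Measure (OG d)) [μ.IsHaarMeasure]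
    [IsProbabilityMeasure μ] (α θ : ℝ) (h0 : 0 < θ) (h1 : θ < π / 2) :
    PD d {z | (∑ i, (z i).1 * Yv α (z i)
        < cos θ * √(∑ i, (z i).1 * (z i).1) * √(∑ i, Yv α (z i) * Yv α (z i)))
      ∧ ∀ i, z i ∈ SA α} ≤ μ (collisionEvent d θ) := by
  set F : Set ((Fin d → ℝ) × (Fin d → ℝ)) :=
    {p | p.1 ⬝ᵥ YV d α p < cos θ * √(p.1 ⬝ᵥ p.1) * √(YV d α p ⬝ᵥ YV d α p)} with hF
  have hFm : MeasurableSet F := by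
    apply measurableSet_lt (meas_dot d _ _ measurable_fst (meas_YV d α))
    exact ((measurable_const.mul (meas_dot d _ _ measurable_fst measurable_fst).sqrt)).mul
      (meas_dot d _ _ (meas_YV d α) (meas_YV d α)).sqrt
  have hAg : MeasurableSet {p : (Fin d → ℝ) × (Fin d → ℝ) | ∀ i, sgn (p.1 i) = sgn (YV d α p i)} := by
    rw [Set.ofPred_forall]
    refine MeasurableSet.iInter fun i => ?_
    exact measurableSet_eq_fun
      (meas_sgn.comp ((measurable_pi_apply i).comp measurable_fst))
      (meas_sgn.comp ((measurable_pi_apply i).comp (meas_YV d α)))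
  have hfub := fub d μ α F hFm (by
    intro A p
    simp only [hF, Set.mem_ofPred_eq, YV_inv, OG_dot])
  have e := fub_pi d μ α _ (hFm.inter hAg)
  have e' : PD d {z | (∑ i, (z i).1 * Yv α (z i)
        < cos θ * √(∑ i, (z i).1 * (z i).1) * √(∑ i, Yv α (z i) * Yv α (z i)))
      ∧ ∀ i, z i ∈ SA α} = ((GD d).prod (GD d)) (F ∩ {p | ∀ i, sgn (p.1 i) = sgn (YV d α p i)}) := by
    rw [e]; rfl
  rw [e', hfub]
  calc ∫⁻ p in F, μ (agreeSet d p.1 (YV d α p)) ∂((GD d).prod (GD d))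
      ≤ ∫⁻ p in F, μ (collisionEvent d θ) ∂((GD d).prod (GD d)) := by
        apply setLIntegral_mono' hFm
        intro p hp
        exact key_lower d hd μ θ h0 h1 _ _ hp
    _ ≤ μ (collisionEvent d θ) := by
        rw [setLIntegral_const]
        exact mul_le_of_le_one_right' prob_le_one

lemma upper_pi (d : ℕ) (hd : 2 ≤ d) (μ : Measure (OG d)) [μ.IsHaarMeasure]
    [IsProbabilityMeasure μ] (α θ : ℝ) (h0 : 0 < θ) (h1 : θ < π / 2) :
    μ (collisionEvent d θ) * PD d {z | cos θ * √(∑ i, (z i).1 * (z i).1) *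
        √(∑ i, Yv α (z i) * Yv α (z i)) < ∑ i, (z i).1 * Yv α (z i)} ≤ (g2 (SA α)) ^ d := by
  set F : Set ((Fin d → ℝ) × (Fin d → ℝ)) :=
    {p | cos θ * √(p.1 ⬝ᵥ p.1) * √(YV d α p ⬝ᵥ YV d α p) < p.1 ⬝ᵥ YV d α p} with hF
  have hFm : MeasurableSet F := by
    refine measurableSet_lt ?_ (meas_dot d _ _ measurable_fst (meas_YV d α))
    exact ((measurable_const.mul (meas_dot d _ _ measurable_fst measurable_fst).sqrt)).mul
      (meas_dot d _ _ (meas_YV d α) (meas_YV d α)).sqrt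
  have hAg : MeasurableSet {p : (Fin d → ℝ) × (Fin d → ℝ) | ∀ i, sgn (p.1 i) = sgn (YV d α p i)} := by
    rw [Set.ofPred_forall]
    refine MeasurableSet.iInter fun i => ?_
    exact measurableSet_eq_fun
      (meas_sgn.comp ((measurable_pi_apply i).comp measurable_fst))
      (meas_sgn.comp ((measurable_pi_apply i).comp (meas_YV d α)))
  have hfub := fub d μ α F hFm (by
    intro A p
    simp only [hF, Set.mem_ofPred_eq, YV_inv, OG_dot])
  have e' : PD d {z | cos θ * √(∑ i, (z i).1 * (z i).1) *
        √(∑ i, Yv α (z i) * Yv α (z i)) < ∑ i, (z i).1 * Yv α (z i)} = ((GD d).prod (GD d)) F := by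
    rw [fub_pi d μ α _ hFm]; rfl
  have e2 : (g2 (SA α)) ^ d
      = ((GD d).prod (GD d)) {p | ∀ i, sgn (p.1 i) = sgn (YV d α p i)} := by
    rw [fub_pi d μ α _ hAg]
    have : {z : Fin d → ℝ × ℝ | (fun i => (z i).1, fun i => (z i).2) ∈
        {p : (Fin d → ℝ) × (Fin d → ℝ) | ∀ i, sgn (p.1 i) = sgn (YV d α p i)}}
        = Set.univ.pi (fun _ => SA α) := by
      ext z
      simp only [Set.mem_pi, Set.mem_univ, true_imp_iff]
      rfl
    rw [this, Measure.pi_pi]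
    simp
  rw [e', e2, ← setLIntegral_const]
  calc ∫⁻ p in F, μ (collisionEvent d θ) ∂((GD d).prod (GD d))
      ≤ ∫⁻ p in F, μ (agreeSet d p.1 (YV d α p)) ∂((GD d).prod (GD d)) := by
        apply setLIntegral_mono' hFm
        intro p hp
        exact key_upper d hd μ θ h0 h1 _ _ hp
    _ ≤ _ := by
        rw [← hfub]
        exact measure_mono Set.inter_subset_right

lemma wlln (ν : Measure (ℝ × ℝ)) [IsProbabilityMeasure ν] (f : ℝ × ℝ → ℝ) (hf : MemLp f 2 ν)
    (δ η : ℝ) (hδ : 0 < δ) (hη : 0 < η) :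
    ∀ᶠ d : ℕ in atTop, (Measure.pi (fun _ : Fin d => ν))
      {z | d * δ ≤ |∑ i, f (z i) - d * ∫ p, f p ∂ν|} ≤ ENNReal.ofReal η := by
  have ht : Tendsto (fun d : ℕ => Var[f; ν] / δ ^ 2 / (d : ℝ)) atTop (nhds 0) :=
    tendsto_const_div_atTop_nhds_zero_nat _
  filter_upwards [ht.eventually (gt_mem_nhds hη), eventually_gt_atTop 0] with d hd hd0
  have hd0' : (0:ℝ) < d := by exact_mod_cast hd0
  have hmem : ∀ i : Fin d, MemLp (fun z : Fin d → ℝ × ℝ => f (z i)) 2 (Measure.pi (fun _ => ν)) :=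
    fun i => hf.comp_measurePreserving (measurePreserving_eval _ i)
  have hsum : MemLp (∑ i : Fin d, fun z : Fin d → ℝ × ℝ => f (z i)) 2 (Measure.pi (fun _ => ν)) :=
    memLp_finsetSum' _ fun i _ => hmem i
  have hvar : Var[∑ i : Fin d, fun z : Fin d → ℝ × ℝ => f (z i); Measure.pi (fun _ => ν)]
      = d * Var[f; ν] := by
    rw [variance_sum_pi (X := fun _ => f) (fun _ => hf)]; simp
  have hmean : ∫ z, (∑ i : Fin d, fun z : Fin d → ℝ × ℝ => f (z i)) z ∂(Measure.pi (fun _ => ν))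
      = d * ∫ p, f p ∂ν := by
    simp only [Finset.sum_apply]
    rw [integral_finsetSum _ (fun i _ => (hmem i).integrable (by norm_num))]
    have : ∀ i : Fin d, ∫ z : Fin d → ℝ × ℝ, f (z i) ∂(Measure.pi (fun _ => ν)) = ∫ p, f p ∂ν := by
      intro i
      have hmp := measurePreserving_eval (fun _ : Fin d => ν) i
      have h2 : ∫ p, f p ∂(Measure.map (Function.eval i) (Measure.pi (fun _ : Fin d => ν)))
          = ∫ z : Fin d → ℝ × ℝ, f (z i) ∂(Measure.pi (fun _ => ν)) := by
        rw [integral_map (measurable_pi_apply i).aemeasurable]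
        change AEStronglyMeasurable f (Measure.map (Function.eval i) (Measure.pi (fun _ : Fin d => ν)))
        rw [hmp.map_eq]; exact hf.aestronglyMeasurable
      rw [← h2, hmp.map_eq]
    simp [this]
  have hch := meas_ge_le_variance_div_sq hsum (c := d * δ) (by positivity)
  rw [hmean, hvar] at hch
  simp only [Finset.sum_apply] at hch
  refine hch.trans (ENNReal.ofReal_le_ofReal ?_)
  have : d * Var[f; ν] / (d * δ) ^ 2 = Var[f; ν] / δ ^ 2 / (d : ℝ) := by
    field_simp
  rw [this]; exact hd.le

lemma memX : MemLp (fun p : ℝ × ℝ => p.1) 4 g2 :=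
  (memLp_id_gaussianReal' 4 (by simp)).comp_measurePreserving measurePreserving_fst

lemma memZ : MemLp (fun p : ℝ × ℝ => p.2) 4 g2 :=
  (memLp_id_gaussianReal' 4 (by simp)).comp_measurePreserving measurePreserving_snd

lemma memY (α : ℝ) : MemLp (Yv α) 4 g2 := (memX.const_mul _).add (memZ.const_mul _)

lemma mem_mul {f g : ℝ × ℝ → ℝ} {ν : Measure (ℝ × ℝ)} (hf : MemLp f 4 ν) (hg : MemLp g 4 ν) :
    MemLp (fun p => f p * g p) 2 ν := by
  have : ENNReal.HolderTriple 4 4 2 := ⟨by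
    have e4 : (4 : ℝ≥0∞) = 2 * 2 := by norm_num
    rw [e4, ENNReal.mul_inv (by simp) (by simp), ← two_mul, ← mul_assoc, ENNReal.mul_inv_cancel (by simp) (by simp), one_mul]⟩
  exact MemLp.mul' hg hf

lemma g2_density : g2 = (volume : Measure (ℝ × ℝ)).withDensity
    (fun p => gaussianPDF 0 1 p.1 * gaussianPDF 0 1 p.2) := by
  unfold g2 gm
  rw [gaussianReal_of_var_ne_zero 0 (by simp), prod_withDensity (by fun_prop) (by fun_prop)]
  rfl

lemma polar_set (S : Set (ℝ × ℝ)) (hS : MeasurableSet S) (T : Set ℝ) (hT : MeasurableSet T)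
    (f : ℝ × ℝ → ℝ) (h : ℝ → ℝ) (k : ℕ)
    (hST : ∀ r > 0, ∀ ψ ∈ Set.Ioo (-π) π, ((r * cos ψ, r * sin ψ) ∈ S ↔ ψ ∈ T))
    (hf : ∀ r > 0, ∀ ψ, f (r * cos ψ, r * sin ψ) = r ^ k * h ψ) :
    ∫ p in S, f p ∂g2 = (2 * π)⁻¹ * (∫ r in Set.Ioi (0:ℝ), r ^ (k + 1) * exp (-(r ^ 2) / 2))
      * ∫ ψ in Set.Ioo (-π) π ∩ T, h ψ := by
  rw [← integral_indicator hS, g2_density,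
    integral_withDensity_eq_integral_toReal_smul (by fun_prop)
      (Eventually.of_forall fun p => ENNReal.mul_lt_top (by simp [gaussianPDF]) (by simp [gaussianPDF])),
    ← integral_comp_polarCoord_symm, polarCoord_target]
  have e : ∫ p in Set.Ioi (0:ℝ) ×ˢ Set.Ioo (-π) π, p.1 • ((gaussianPDF 0 1 (polarCoord.symm p).1 *
        gaussianPDF 0 1 (polarCoord.symm p).2).toReal • S.indicator f (polarCoord.symm p))
      = ∫ p in Set.Ioi (0:ℝ) ×ˢ Set.Ioo (-π) π,
        ((2 * π)⁻¹ * (p.1 ^ (k + 1) * exp (-(p.1 ^ 2) / 2))) * T.indicator h p.2 := by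
    apply setIntegral_congr_fun (measurableSet_Ioi.prod measurableSet_Ioo)
    rintro ⟨r, ψ⟩ ⟨hr, hψ⟩
    have hr' : 0 < r := hr
    simp only [polarCoord_symm_apply, smul_eq_mul, ENNReal.toReal_mul, toReal_gaussianPDF]
    have hind : S.indicator f (r * cos ψ, r * sin ψ) = r ^ k * T.indicator h ψ := by
      by_cases hm : ψ ∈ T
      · rw [Set.indicator_of_mem hm, Set.indicator_of_mem ((hST r hr' ψ hψ).2 hm), hf r hr']
      · rw [Set.indicator_of_notMem hm,
          Set.indicator_of_notMem (fun hc => hm ((hST r hr' ψ hψ).1 hc)), mul_zero]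
    rw [hind]
    have hpdf : gaussianPDFReal 0 1 (r * cos ψ) * gaussianPDFReal 0 1 (r * sin ψ)
        = (2 * π)⁻¹ * exp (-(r ^ 2) / 2) := by
      simp only [gaussianPDFReal, NNReal.coe_one, mul_one, sub_zero]
      rw [mul_mul_mul_comm, ← Real.exp_add, ← mul_inv, Real.mul_self_sqrt (by positivity)]
      congr 2
      have := sin_sq_add_cos_sq ψ
      linear_combination (-(r ^ 2) / 2) * this
    rw [hpdf]; ring
  rw [e, Measure.volume_eq_prod, setIntegral_prod_mul
    (fun r => ((2 * π)⁻¹ * (r ^ (k + 1) * exp (-(r ^ 2) / 2)))) (fun ψ => T.indicator h ψ),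
    integral_const_mul, setIntegral_indicator hT]

lemma rad1 : ∫ r in Set.Ioi (0:ℝ), r ^ (0 + 1) * exp (-(r ^ 2) / 2) = 1 := by
  have h := integral_rpow_mul_exp_neg_mul_rpow (p := 2) (q := 1) (b := 1/2) (by norm_num) (by norm_num) (by norm_num)
  have e : ∫ r in Set.Ioi (0:ℝ), r ^ (0 + 1) * exp (-(r ^ 2) / 2)
      = ∫ x in Set.Ioi (0:ℝ), x ^ (1:ℝ) * exp (-(1/2) * x ^ (2:ℝ)) := by
    apply setIntegral_congr_fun measurableSet_Ioi
    intro x _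
    simp only [Real.rpow_one, Real.rpow_two, zero_add, pow_one]
    congr 2; ring
  rw [e, h]
  norm_num [Real.rpow_neg, Real.rpow_one]

lemma rad3 : ∫ r in Set.Ioi (0:ℝ), r ^ (2 + 1) * exp (-(r ^ 2) / 2) = 2 := by
  have h := integral_rpow_mul_exp_neg_mul_rpow (p := 2) (q := 3) (b := 1/2) (by norm_num) (by norm_num) (by norm_num)
  have e : ∫ r in Set.Ioi (0:ℝ), r ^ (2 + 1) * exp (-(r ^ 2) / 2)
      = ∫ x in Set.Ioi (0:ℝ), x ^ (3:ℝ) * exp (-(1/2) * x ^ (2:ℝ)) := by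
    apply setIntegral_congr_fun measurableSet_Ioi
    intro x _
    have : (3:ℝ) = ((3:ℕ):ℝ) := by norm_num
    simp only [this, Real.rpow_natCast, Real.rpow_two]
    congr 2; ring
  rw [e, h]
  have h4 : ((3:ℝ) + 1) / 2 = 2 := by norm_num
  have h5 : -((3:ℝ) + 1) / 2 = -2 := by norm_num
  rw [h4, h5, Real.Gamma_two, Real.rpow_neg (by norm_num), Real.rpow_two]; norm_num

def TA (α : ℝ) : Set ℝ := {ψ | sgn (cos ψ) = sgn (cos (ψ - α))}

lemma meas_TA (α : ℝ) : MeasurableSet (TA α) :=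
  measurableSet_eq_fun (meas_sgn.comp (by fun_prop)) (meas_sgn.comp (by fun_prop))

lemma SA_TA (α : ℝ) (r : ℝ) (hr : 0 < r) (ψ : ℝ) : (r * cos ψ, r * sin ψ) ∈ SA α ↔ ψ ∈ TA α := by
  have : Yv α (r * cos ψ, r * sin ψ) = r * cos (ψ - α) := by
    simp only [Yv, cos_sub]; ring
  simp only [SA, TA, Set.mem_ofPred_eq, this, sgn_pos_mul hr]

lemma sgn_eq_iff (p q : ℝ) : sgn p = sgn q ↔ (0 ≤ p ↔ 0 ≤ q) := by
  unfold sgn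
  by_cases hp : 0 ≤ p <;> by_cases hq : 0 ≤ q <;> simp [hp, hq] <;> norm_num

lemma TA_eq (α : ℝ) (h0 : 0 < α) (h1 : α < π / 2) : Set.Ioo (-π) π ∩ TA α =
    (Set.Icc (α - π / 2) (π / 2) ∪ Set.Ioo (-π) (-(π / 2))) ∪ Set.Ioo (α + π / 2) π := by
  have hpi := pi_pos
  have hc1 : ∀ ψ, ψ ∈ Set.Ioo (-π) π → (0 ≤ cos ψ ↔ (-(π/2) ≤ ψ ∧ ψ ≤ π/2)) := by
    rintro ψ ⟨ha, hb⟩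
    constructor
    · intro h
      by_contra hcon
      rw [not_and_or] at hcon
      push Not at hcon
      rcases hcon with hc | hc
      · have := cos_neg_of_pi_div_two_lt_of_lt (x := -ψ) (by linarith) (by linarith)
        rw [cos_neg] at this; linarith
      · have := cos_neg_of_pi_div_two_lt_of_lt (x := ψ) (by linarith) (by linarith)
        linarith
    · rintro ⟨h2, h3⟩
      exact cos_nonneg_of_neg_pi_div_two_le_of_le h2 h3
  have hc2 : ∀ ψ, ψ ∈ Set.Ioo (-π) π → (0 ≤ cos (ψ - α) ↔ (α - π/2 ≤ ψ ∧ ψ ≤ α + π/2)) := by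
    rintro ψ ⟨ha, hb⟩
    constructor
    · intro h
      by_contra hcon
      rw [not_and_or] at hcon
      push Not at hcon
      rcases hcon with hc | hc
      · have := cos_neg_of_pi_div_two_lt_of_lt (x := -(ψ - α)) (by linarith) (by linarith)
        rw [cos_neg] at this; linarith
      · have := cos_neg_of_pi_div_two_lt_of_lt (x := ψ - α) (by linarith) (by linarith)
        linarith
    · rintro ⟨h2, h3⟩
      exact cos_nonneg_of_neg_pi_div_two_le_of_le (by linarith) (by linarith)
  ext ψ
  constructor
  · rintro ⟨hm, ht⟩
    have hs := (sgn_eq_iff _ _).1 ht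
    rw [hc1 ψ hm, hc2 ψ hm] at hs
    obtain ⟨ha, hb⟩ := hm
    by_cases c1 : -(π/2) ≤ ψ
    · by_cases c2 : ψ ≤ π/2
      · have := hs.1 ⟨c1, c2⟩
        exact Or.inl (Or.inl ⟨this.1, c2⟩)
      · right
        refine ⟨?_, hb⟩
        by_contra hc
        push Not at hc c2
        exact absurd (hs.2 ⟨by linarith, hc⟩).2 (by linarith)
    · left; right
      exact ⟨ha, by linarith⟩
  · intro h
    have hm : ψ ∈ Set.Ioo (-π) π := by
      rcases h with (⟨a, b⟩ | ⟨a, b⟩) | ⟨a, b⟩ <;> constructor <;> linarith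
    refine ⟨hm, (sgn_eq_iff _ _).2 ?_⟩
    rw [hc1 ψ hm, hc2 ψ hm]
    rcases h with (⟨a, b⟩ | ⟨a, b⟩) | ⟨a, b⟩
    · exact ⟨fun _ => ⟨a, by linarith⟩, fun _ => ⟨by linarith, b⟩⟩
    · exact ⟨fun h => absurd h.1 (by linarith), fun h => absurd h.1 (by linarith)⟩
    · exact ⟨fun h => absurd h.2 (by linarith), fun h => absurd h.2 (by linarith)⟩

lemma ang (α : ℝ) (h0 : 0 < α) (h1 : α < π / 2) (k K : ℝ → ℝ) (hk : Continuous k)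
    (hK : ∀ x, HasDerivAt K (k x) x) : ∫ ψ in Set.Ioo (-π) π ∩ TA α, k ψ
      = (K (π / 2) - K (α - π / 2)) + (K (-(π / 2)) - K (-π)) + (K π - K (α + π / 2)) := by
  have hpi := pi_pos
  have hI : ∀ a b, IntegrableOn k (Set.Ioo a b) := fun a b =>
    (hk.integrableOn_Icc (a := a) (b := b)).mono_set Set.Ioo_subset_Icc_self
  have hint : ∀ a b, a ≤ b → ∫ ψ in Set.Ioo a b, k ψ = K b - K a := by
    intro a b hab
    rw [← integral_Ioc_eq_integral_Ioo, ← intervalIntegral.integral_of_le hab]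
    exact intervalIntegral.integral_eq_sub_of_hasDerivAt (fun x _ => hK x) (hk.intervalIntegrable _ _)
  rw [TA_eq α h0 h1, setIntegral_union, setIntegral_union, integral_Icc_eq_integral_Ioc,
    integral_Ioc_eq_integral_Ioo, hint _ _ (by linarith), hint _ _ (by linarith),
    hint _ _ (by linarith)]
  · rw [Set.disjoint_left]; rintro x ⟨a, b⟩ ⟨c, e⟩; linarith
  · exact measurableSet_Ioo
  · exact hk.integrableOn_Icc
  · exact hI _ _
  · rw [Set.disjoint_left]; rintro x (⟨a, b⟩ | ⟨a, b⟩) ⟨c, e⟩ <;> linarith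
  · exact measurableSet_Ioo
  · exact hk.integrableOn_Icc.union (hI _ _)
  · exact hI _ _

lemma deriv_sin2 (c x : ℝ) : HasDerivAt (fun x => x / 2 + sin (2 * (x - c)) / 4) (cos (x - c) * cos (x - c)) x := by
  have h1 : HasDerivAt (fun x : ℝ => 2 * (x - c)) 2 x := by
    simpa using ((hasDerivAt_id x).sub_const c).const_mul 2
  have h2 := ((hasDerivAt_id x).div_const 2).add ((h1.sin).div_const 4)
  have e : cos (x - c) * cos (x - c) = 1 / 2 + cos (2 * (x - c)) * 2 / 4 := by
    rw [cos_two_mul]; ring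
  rw [e]
  exact h2

lemma deriv_sin2' (α x : ℝ) : HasDerivAt (fun x => x * cos α / 2 + sin (2 * x - α) / 4)
    (cos x * cos (x - α)) x := by
  have h1 : HasDerivAt (fun x : ℝ => 2 * x - α) 2 x := by
    simpa using ((hasDerivAt_id x).const_mul 2).sub_const α
  have h2 := (((hasDerivAt_id x).mul_const (cos α)).div_const 2).add ((h1.sin).div_const 4)
  have e : cos x * cos (x - α) = 1 * cos α / 2 + cos (2 * x - α) * 2 / 4 := by
    have e1 : cos (2 * x - α) = cos (x + (x - α)) := by congr 1; ring
    have e2 : cos α = cos (x - (x - α)) := by congr 1; ring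
    rw [e1, e2, cos_add, cos_sub x (x - α)]; ring
  rw [e]
  exact h2

lemma Yv_polar (α r ψ : ℝ) : Yv α (r * cos ψ, r * sin ψ) = r * cos (ψ - α) := by
  simp only [Yv, cos_sub]; ring

lemma prob_SA (α : ℝ) (h0 : 0 < α) (h1 : α < π / 2) : (g2 (SA α)).toReal = 1 - α / π := by
  have h := polar_set (SA α) (meas_SA α) (TA α) (meas_TA α) (fun _ => 1) (fun _ => 1) 0
    (fun r hr ψ _ => SA_TA α r hr ψ) (by simp)
  rw [rad1, ang α h0 h1 (fun _ => 1) id continuous_const (fun x => hasDerivAt_id x)] at h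
  have h2 : ∫ p in SA α, (1:ℝ) ∂g2 = (g2 (SA α)).toReal := by simp [Measure.real]
  rw [← h2, h]
  have := pi_pos
  simp only [id]
  field_simp
  ring

lemma mXX (α : ℝ) (h0 : 0 < α) (h1 : α < π / 2) :
    ∫ p in SA α, p.1 * p.1 ∂g2 = (π - α + sin α * cos α) / π := by
  have h := polar_set (SA α) (meas_SA α) (TA α) (meas_TA α) (fun p => p.1 * p.1)
    (fun ψ => cos (ψ - 0) * cos (ψ - 0)) 2
    (fun r hr ψ _ => SA_TA α r hr ψ) (by intro r _ ψ; simp; ring)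
  rw [rad3, ang α h0 h1 _ _ (by fun_prop) (fun x => deriv_sin2 0 x)] at h
  rw [h]
  have hpi := pi_pos
  have e1 : sin (2 * (π / 2 - 0)) = 0 := by rw [show 2 * (π / 2 - 0) = π by ring]; simp
  have e2 : sin (2 * (α - π / 2 - 0)) = - (2 * sin α * cos α) := by
    rw [show 2 * (α - π / 2 - 0) = 2 * α - π by ring, sin_sub_pi, sin_two_mul]
  have e3 : sin (2 * (-(π / 2) - 0)) = 0 := by rw [show 2 * (-(π / 2) - 0) = -π by ring]; simp
  have e4 : sin (2 * (-π - 0)) = 0 := by rw [show 2 * (-π - 0) = -(2 * π) by ring]; simp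
  have e5 : sin (2 * (π - 0)) = 0 := by rw [show 2 * (π - 0) = (2 * π) by ring]; simp
  have e6 : sin (2 * (α + π / 2 - 0)) = - (2 * sin α * cos α) := by
    rw [show 2 * (α + π / 2 - 0) = 2 * α + π by ring, sin_add_pi, sin_two_mul]
  rw [e1, e2, e3, e4, e5, e6]
  field_simp
  ring

lemma mYY (α : ℝ) (h0 : 0 < α) (h1 : α < π / 2) :
    ∫ p in SA α, Yv α p * Yv α p ∂g2 = (π - α + sin α * cos α) / π := by
  have h := polar_set (SA α) (meas_SA α) (TA α) (meas_TA α) (fun p => Yv α p * Yv α p)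
    (fun ψ => cos (ψ - α) * cos (ψ - α)) 2
    (fun r hr ψ _ => SA_TA α r hr ψ) (by intro r _ ψ; simp only [Yv_polar]; ring)
  rw [rad3, ang α h0 h1 _ _ (by fun_prop) (fun x => deriv_sin2 α x)] at h
  rw [h]
  have hpi := pi_pos
  have e1 : sin (2 * (π / 2 - α)) = 2 * sin α * cos α := by
    rw [show 2 * (π / 2 - α) = π - 2 * α by ring, sin_pi_sub, sin_two_mul]
  have e2 : sin (2 * (α - π / 2 - α)) = 0 := by
    rw [show 2 * (α - π / 2 - α) = -π by ring]; simp
  have e3 : sin (2 * (-(π / 2) - α)) = 2 * sin α * cos α := by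
    rw [show 2 * (-(π / 2) - α) = -(2 * α + π) by ring, sin_neg, sin_add_pi, sin_two_mul]; ring
  have e4 : sin (2 * (-π - α)) = -(2 * sin α * cos α) := by
    rw [show 2 * (-π - α) = -(2 * α + 2 * π) by ring, sin_neg, sin_add_two_pi, sin_two_mul]
  have e5 : sin (2 * (π - α)) = -(2 * sin α * cos α) := by
    rw [show 2 * (π - α) = (2 * π - 2 * α) by ring, sin_two_pi_sub, sin_two_mul]
  have e6 : sin (2 * (α + π / 2 - α)) = 0 := by
    rw [show 2 * (α + π / 2 - α) = π by ring]; simp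
  rw [e1, e2, e3, e4, e5, e6]
  field_simp
  ring

lemma mXY (α : ℝ) (h0 : 0 < α) (h1 : α < π / 2) :
    ∫ p in SA α, p.1 * Yv α p ∂g2 = ((π - α) * cos α + sin α) / π := by
  have h := polar_set (SA α) (meas_SA α) (TA α) (meas_TA α) (fun p => p.1 * Yv α p)
    (fun ψ => cos ψ * cos (ψ - α)) 2
    (fun r hr ψ _ => SA_TA α r hr ψ) (by intro r _ ψ; simp only [Yv_polar]; ring)
  rw [rad3, ang α h0 h1 _ _ (by fun_prop) (fun x => deriv_sin2' α x)] at h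
  rw [h]
  have hpi := pi_pos
  have e1 : sin (2 * (π / 2) - α) = sin α := by
    rw [show 2 * (π / 2) - α = π - α by ring, sin_pi_sub]
  have e2 : sin (2 * (α - π / 2) - α) = - sin α := by
    rw [show 2 * (α - π / 2) - α = α - π by ring, sin_sub_pi]
  have e3 : sin (2 * (-(π / 2)) - α) = sin α := by
    rw [show 2 * (-(π / 2)) - α = -(α + π) by ring, sin_neg, sin_add_pi]; ring
  have e4 : sin (2 * (-π) - α) = - sin α := by
    rw [show 2 * (-π) - α = -(α + 2 * π) by ring, sin_neg, sin_add_two_pi]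
  have e5 : sin (2 * π - α) = - sin α := by
    rw [sin_two_pi_sub]
  have e6 : sin (2 * (α + π / 2) - α) = - sin α := by
    rw [show 2 * (α + π / 2) - α = α + π by ring, sin_add_pi]
  rw [e1, e2, e3, e4, e5, e6]
  field_simp
  ring

lemma mean_full (α θ : ℝ) :
    ∫ p, (p.1 * Yv α p - cos θ / 2 * (p.1 * p.1 + Yv α p * Yv α p)) ∂g2 = cos α - cos θ := by
  have h := polar_set Set.univ MeasurableSet.univ Set.univ MeasurableSet.univ
    (fun p => p.1 * Yv α p - cos θ / 2 * (p.1 * p.1 + Yv α p * Yv α p))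
    (fun ψ => cos ψ * cos (ψ - α) - cos θ / 2 *
      (cos (ψ - 0) * cos (ψ - 0) + cos (ψ - α) * cos (ψ - α))) 2
    (by simp) (by intro r _ ψ; simp only [Yv_polar, sub_zero]; ring)
  have hpi := pi_pos
  have hd : ∀ x, HasDerivAt _ _ x := fun x => (deriv_sin2' α x).sub
    (((deriv_sin2 0 x).add (deriv_sin2 α x)).const_mul (cos θ / 2))
  rw [rad3, Set.inter_univ, ← integral_Ioc_eq_integral_Ioo,
    ← intervalIntegral.integral_of_le (by linarith),
    intervalIntegral.integral_eq_sub_of_hasDerivAt (fun x _ => hd x)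
      (Continuous.intervalIntegrable (by fun_prop) _ _), setIntegral_univ] at h
  rw [h]
  have e1 : sin (2 * π - α) = - sin α := sin_two_pi_sub _
  have e2 : sin (2 * (-π) - α) = - sin α := by
    rw [show 2 * (-π) - α = -(α + 2 * π) by ring, sin_neg, sin_add_two_pi]
  have e3 : sin (2 * (π - 0)) = 0 := by rw [show 2 * (π - 0) = (2 * π) by ring]; simp
  have e4 : sin (2 * (-π - 0)) = 0 := by rw [show 2 * (-π - 0) = -(2 * π) by ring]; simp
  have e5 : sin (2 * (π - α)) = -(2 * sin α * cos α) := by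
    rw [show 2 * (π - α) = (2 * π - 2 * α) by ring, sin_two_pi_sub, sin_two_mul]
  have e6 : sin (2 * (-π - α)) = -(2 * sin α * cos α) := by
    rw [show 2 * (-π - α) = -(2 * α + 2 * π) by ring, sin_neg, sin_add_two_pi, sin_two_mul]
  simp only [Pi.add_apply, Pi.sub_apply, e1, e2, e3, e4, e5, e6]
  field_simp
  ring

lemma upper_bd (μ : (d : ℕ) → Measure (Matrix.orthogonalGroup (Fin d) ℝ))
    (hHaar : ∀ d, (μ d).IsHaarMeasure) (hProb : ∀ d, IsProbabilityMeasure (μ d))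
    (α θ : ℝ) (h0 : 0 < α) (hαθ : α < θ) (h1 : θ < π / 2) :
    ∀ᶠ d : ℕ in atTop, collProb d θ (μ d) ≤ 2 * (1 - α / π) ^ d := by
  have hpi := pi_pos
  set f : ℝ × ℝ → ℝ := fun p => p.1 * Yv α p - cos θ / 2 * (p.1 * p.1 + Yv α p * Yv α p) with hf
  have hmem : MemLp f 2 g2 := (mem_mul memX (memY α)).sub
    (((mem_mul memX memX).add (mem_mul (memY α) (memY α))).const_mul _)
  have hδ : 0 < cos α - cos θ := sub_pos.2 (cos_lt_cos_of_nonneg_of_le_pi h0.le (by linarith) hαθ)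
  have hc : 0 < cos θ := cos_pos_of_mem_Ioo ⟨by linarith, h1⟩
  have hw := wlln g2 f hmem (cos α - cos θ) (1/2) hδ (by norm_num)
  filter_upwards [hw, eventually_ge_atTop 2] with d hd hd2
  have := hHaar d
  have := hProb d
  have hup := upper_pi d hd2 (μ d) α θ (by linarith) h1
  set Gd : Set (Fin d → ℝ × ℝ) := {z | cos θ * √(∑ i, (z i).1 * (z i).1) *
        √(∑ i, Yv α (z i) * Yv α (z i)) < ∑ i, (z i).1 * Yv α (z i)} with hG
  rw [hf, mean_full α θ] at hd
  set Bd : Set (Fin d → ℝ × ℝ) := {z | (d:ℝ) * (cos α - cos θ) ≤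
    |∑ i, (fun p : ℝ × ℝ => p.1 * Yv α p - cos θ / 2 * (p.1 * p.1 + Yv α p * Yv α p)) (z i)
      - d * (cos α - cos θ)|} with hB
  have hcov : (Set.univ : Set (Fin d → ℝ × ℝ)) ⊆ Gd ∪ Bd := by
    intro z _
    by_cases hz : z ∈ Bd
    · exact Or.inr hz
    · left
      simp only [hB, Set.mem_ofPred_eq, not_le, abs_lt] at hz
      have hz1 := hz.1
      rw [Finset.sum_sub_distrib, ← Finset.mul_sum, Finset.sum_add_distrib] at hz1
      simp only [hG, Set.mem_ofPred_eq]
      set p := ∑ i, (z i).1 * (z i).1 with hp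
      set q := ∑ i, Yv α (z i) * Yv α (z i) with hq
      have hp0 : 0 ≤ p := Finset.sum_nonneg fun i _ => mul_self_nonneg _
      have hq0 : 0 ≤ q := Finset.sum_nonneg fun i _ => mul_self_nonneg _
      have hamgm : √p * √q ≤ (p + q) / 2 := by
        nlinarith [sq_nonneg (√p - √q), Real.sq_sqrt hp0, Real.sq_sqrt hq0]
      have : cos θ * √p * √q ≤ cos θ / 2 * (p + q) := by
        calc cos θ * √p * √q = cos θ * (√p * √q) := by ring
          _ ≤ cos θ * ((p + q) / 2) := by gcongr
          _ = _ := by ring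
      linarith
  have hone : (1 : ℝ) ≤ (PD d Gd).toReal + 1 / 2 := by
    have h2 : (1 : ℝ≥0∞) ≤ PD d Gd + ENNReal.ofReal (1/2) := by
      calc (1 : ℝ≥0∞) = PD d Set.univ := by simp
        _ ≤ PD d (Gd ∪ Bd) := measure_mono hcov
        _ ≤ PD d Gd + PD d Bd := measure_union_le _ _
        _ ≤ _ := by gcongr
    have h3 := ENNReal.toReal_mono (by finiteness) h2
    rwa [ENNReal.toReal_add (by finiteness) (by finiteness), ENNReal.toReal_ofReal (by norm_num),
      ENNReal.toReal_one] at h3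
  have hup' := ENNReal.toReal_mono (by finiteness) hup
  rw [ENNReal.toReal_mul, ENNReal.toReal_pow, prob_SA α h0 (by linarith)] at hup'
  have hp0 : 0 ≤ (μ d (collisionEvent d θ)).toReal := ENNReal.toReal_nonneg
  unfold collProb
  nlinarith

lemma pi_cond (d : ℕ) (S : Set (ℝ × ℝ)) (hS : MeasurableSet S) (h0 : g2 S ≠ 0)
    (E : Set (Fin d → ℝ × ℝ)) :
    PD d (E ∩ {z | ∀ i, z i ∈ S}) = (g2 S) ^ d * (Measure.pi (fun _ : Fin d => g2[|S])) E := by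
  have := cond_isProbabilityMeasure h0
  have hset : {z : Fin d → ℝ × ℝ | ∀ i, z i ∈ S} = Set.univ.pi (fun _ => S) := by
    ext z; simp
  have hm : MeasurableSet {z : Fin d → ℝ × ℝ | ∀ i, z i ∈ S} := by
    rw [hset]; exact MeasurableSet.univ_pi fun _ => hS
  have key : (PD d).restrict {z | ∀ i, z i ∈ S}
      = (g2 S) ^ d • (Measure.pi (fun _ : Fin d => g2[|S])) := by
    rw [hset]
    unfold PD
    rw [Measure.restrict_pi_pi]
    apply Measure.pi_eq
    intro s hs
    rw [Measure.smul_apply, Measure.pi_pi, smul_eq_mul]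
    have : ∀ i, (g2.restrict S) (s i) = g2 S * g2[|S] (s i) := by
      intro i
      rw [ProbabilityTheory.cond, Measure.smul_apply, smul_eq_mul, ← mul_assoc,
        ENNReal.mul_inv_cancel h0 (by finiteness), one_mul]
    simp_rw [this]
    rw [Finset.prod_mul_distrib]
    simp
  rw [← Measure.restrict_apply' hm, key]
  simp

lemma lower_bd (μ : (d : ℕ) → Measure (Matrix.orthogonalGroup (Fin d) ℝ))
    (hHaar : ∀ d, (μ d).IsHaarMeasure) (hProb : ∀ d, IsProbabilityMeasure (μ d))
    (α θ : ℝ) (h0 : 0 < α) (h1 : α < π / 2) (t0 : 0 < θ) (t1 : θ < π / 2)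
    (hab : (π - α) * cos α + sin α < cos θ * (π - α + sin α * cos α)) :
    ∀ᶠ d : ℕ in atTop, 1 / 2 * (1 - α / π) ^ d ≤ collProb d θ (μ d) := by
  have hpi := pi_pos
  have hP := prob_SA α h0 h1
  have hPpos : 0 < 1 - α / π := by
    rw [sub_pos, div_lt_one hpi]; linarith
  have hP0 : g2 (SA α) ≠ 0 := by
    intro h; rw [h] at hP; simp at hP; linarith
  set ν : Measure (ℝ × ℝ) := g2[|SA α] with hν
  have hνp : IsProbabilityMeasure ν := cond_isProbabilityMeasure hP0
  have hmem : ∀ f : ℝ × ℝ → ℝ, MemLp f 4 g2 → MemLp f 4 ν := by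
    intro f hf
    exact (hf.restrict _).smul_measure (by simp [hP0])
  have hint : ∀ f : ℝ × ℝ → ℝ, ∫ p, f p ∂ν = (1 - α / π)⁻¹ * ∫ p in SA α, f p ∂g2 := by
    intro f
    rw [hν, ProbabilityTheory.cond, integral_smul_measure, ENNReal.toReal_inv, hP, smul_eq_mul]
  set a : ℝ := (1 - α / π)⁻¹ * ((π - α + sin α * cos α) / π) with ha
  set b : ℝ := (1 - α / π)⁻¹ * (((π - α) * cos α + sin α) / π) with hb
  have hs : 0 < sin α := sin_pos_of_pos_of_lt_pi h0 (by linarith)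
  have hcα : 0 < cos α := cos_pos_of_mem_Ioo ⟨by linarith, h1⟩
  have hc : 0 < cos θ := cos_pos_of_mem_Ioo ⟨by linarith, t1⟩
  have hc1 : cos θ ≤ 1 := cos_le_one θ
  have hb0 : 0 < b := by
    have : 0 < π - α := by linarith
    positivity
  have hbca : b < cos θ * a := by
    have : cos θ * a = (1 - α / π)⁻¹ * ((cos θ * (π - α + sin α * cos α)) / π) := by
      rw [ha]; ring
    rw [this, hb]
    gcongr
  have ha0 : 0 < a := by
    by_contra h; push Not at h; nlinarith
  set δ : ℝ := (cos θ * a - b) / 4 with hδ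
  have hδ0 : 0 < δ := by rw [hδ]; linarith
  have hδa : δ < a := by
    have : cos θ * a ≤ a := by nlinarith
    rw [hδ]; linarith
  have hX := hmem _ memX
  have hY := hmem _ (memY α)
  have w1 := wlln ν _ (mem_mul hX hX) δ (1/6) hδ0 (by norm_num)
  have w2 := wlln ν _ (mem_mul hY hY) δ (1/6) hδ0 (by norm_num)
  have w3 := wlln ν _ (mem_mul hX hY) δ (1/6) hδ0 (by norm_num)
  rw [hint, mXX α h0 h1] at w1
  rw [hint, mYY α h0 h1] at w2
  rw [hint, mXY α h0 h1] at w3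
  rw [← ha] at w1 w2
  rw [← hb] at w3
  filter_upwards [w1, w2, w3, eventually_ge_atTop 2] with d d1 d2 d3 hd2
  have := hHaar d
  have := hProb d
  have hdpos : (0:ℝ) < d := by
    have : 0 < d := by omega
    exact_mod_cast this
  have hlow := lower_pi d hd2 (μ d) α θ t0 t1
  set E : Set (Fin d → ℝ × ℝ) := {z | ∑ i, (z i).1 * Yv α (z i)
        < cos θ * √(∑ i, (z i).1 * (z i).1) * √(∑ i, Yv α (z i) * Yv α (z i))} with hE
  have hlow' : PD d (E ∩ {z | ∀ i, z i ∈ SA α}) ≤ μ d (collisionEvent d θ) := hlow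
  rw [pi_cond d (SA α) (meas_SA α) hP0, ← hν] at hlow'
  set B1 : Set (Fin d → ℝ × ℝ) := {z | (d:ℝ) * δ ≤ |∑ i, (z i).1 * (z i).1 - d * a|} with hB1
  set B2 : Set (Fin d → ℝ × ℝ) := {z | (d:ℝ) * δ ≤ |∑ i, Yv α (z i) * Yv α (z i) - d * a|} with hB2
  set B3 : Set (Fin d → ℝ × ℝ) := {z | (d:ℝ) * δ ≤ |∑ i, (z i).1 * Yv α (z i) - d * b|} with hB3
  have hcov : (Set.univ : Set (Fin d → ℝ × ℝ)) ⊆ E ∪ (B1 ∪ B2 ∪ B3) := by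
    intro z _
    by_cases z1 : z ∈ B1
    · exact Or.inr (Or.inl (Or.inl z1))
    by_cases z2 : z ∈ B2
    · exact Or.inr (Or.inl (Or.inr z2))
    by_cases z3 : z ∈ B3
    · exact Or.inr (Or.inr z3)
    left
    simp only [hB1, hB2, hB3, Set.mem_ofPred_eq, not_le, abs_lt] at z1 z2 z3
    simp only [hE, Set.mem_ofPred_eq]
    set p := ∑ i, (z i).1 * (z i).1 with hp
    set q := ∑ i, Yv α (z i) * Yv α (z i) with hq
    have hpos : 0 ≤ d * (a - δ) := mul_nonneg hdpos.le (by linarith)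
    have hp' : √(d * (a - δ)) ≤ √p := Real.sqrt_le_sqrt (by linarith [z1.1])
    have hq' : √(d * (a - δ)) ≤ √q := Real.sqrt_le_sqrt (by linarith [z2.1])
    have hpq : d * (a - δ) ≤ √p * √q := by
      calc d * (a - δ) = √(d * (a - δ)) * √(d * (a - δ)) := (Real.mul_self_sqrt hpos).symm
        _ ≤ √p * √q := by gcongr
    have h5 : b + δ ≤ cos θ * (a - δ) := by
      have : cos θ * δ ≤ δ := by nlinarith
      have : cos θ * a - b = 4 * δ := by rw [hδ]; ring
      linarith
    calc ∑ i, (z i).1 * Yv α (z i) < d * (b + δ) := by linarith [z3.2]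
      _ ≤ d * (cos θ * (a - δ)) := by gcongr
      _ = cos θ * (d * (a - δ)) := by ring
      _ ≤ cos θ * (√p * √q) := by gcongr
      _ = _ := by ring
  set Q : Measure (Fin d → ℝ × ℝ) := Measure.pi (fun _ : Fin d => ν) with hQ
  have hone : (1 : ℝ) ≤ (Q E).toReal + 1 / 2 := by
    have h2 : (1 : ℝ≥0∞) ≤ Q E + (ENNReal.ofReal (1/6) + ENNReal.ofReal (1/6) + ENNReal.ofReal (1/6)) := by
      calc (1 : ℝ≥0∞) = Q Set.univ := by simp [hQ]
        _ ≤ Q (E ∪ (B1 ∪ B2 ∪ B3)) := measure_mono hcov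
        _ ≤ Q E + Q (B1 ∪ B2 ∪ B3) := measure_union_le _ _
        _ ≤ Q E + (Q B1 + Q B2 + Q B3) := by
          gcongr
          exact (measure_union_le _ _).trans (by gcongr; exact measure_union_le _ _)
        _ ≤ _ := by gcongr
    rw [← ENNReal.ofReal_add (by norm_num) (by norm_num),
      ← ENNReal.ofReal_add (by norm_num) (by norm_num)] at h2
    have h3 := ENNReal.toReal_mono (by finiteness) h2
    rw [ENNReal.toReal_add (by finiteness) (by finiteness), ENNReal.toReal_ofReal (by norm_num),
      ENNReal.toReal_one] at h3
    linarith
  have hl := ENNReal.toReal_mono (by finiteness) hlow'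
  rw [ENNReal.toReal_mul, ENNReal.toReal_pow, hP] at hl
  unfold collProb
  have : 0 < (1 - α / π) ^ d := by positivity
  nlinarith

lemma squeeze (p : ℕ → ℝ) (l q1 q2 : ℝ) (h1 : 0 < q1) (h2 : 0 < q2)
    (ht : Tendsto (fun d : ℕ => (1 / (d : ℝ)) * Real.log (p d)) atTop (nhds l))
    (hl : ∀ᶠ d : ℕ in atTop, 1 / 2 * q1 ^ d ≤ p d)
    (hu : ∀ᶠ d : ℕ in atTop, p d ≤ 2 * q2 ^ d) : log q1 ≤ l ∧ l ≤ log q2 := by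
  have haux : ∀ c q : ℝ, Tendsto (fun d : ℕ => c / (d:ℝ) + log q) atTop (nhds (log q)) := by
    intro c q
    simpa using (tendsto_const_div_atTop_nhds_zero_nat c).add_const (log q)
  constructor
  · refine le_of_tendsto_of_tendsto (haux (log (1/2)) q1) ht ?_
    filter_upwards [hl, eventually_gt_atTop 0] with d hd hd0
    have hd0' : (0:ℝ) < d := by exact_mod_cast hd0
    have := Real.log_le_log (by positivity) hd
    rw [Real.log_mul (by norm_num) (by positivity), Real.log_pow] at this
    calc log (1/2) / d + log q1 = (1 / (d:ℝ)) * (log (1/2) + d * log q1) := by field_simp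
      _ ≤ _ := by gcongr
  · refine le_of_tendsto_of_tendsto ht (haux (log 2) q2) ?_
    filter_upwards [hl, hu, eventually_gt_atTop 0] with d hd hd' hd0
    have hd0' : (0:ℝ) < d := by exact_mod_cast hd0
    have hp : 0 < p d := lt_of_lt_of_le (by positivity) hd
    have := Real.log_le_log hp hd'
    rw [Real.log_mul (by norm_num) (by positivity), Real.log_pow] at this
    calc (1 / (d:ℝ)) * log (p d) ≤ (1 / (d:ℝ)) * (log 2 + d * log q2) := by gcongr
      _ = _ := by field_simp

lemma trig_ineq (θ : ℝ) (h0 : 0 < θ) (h1 : θ ≤ 1 / 10) :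
    (π - (θ + θ ^ 2)) * cos (θ + θ ^ 2) + sin (θ + θ ^ 2)
      < cos θ * (π - (θ + θ ^ 2) + sin (θ + θ ^ 2) * cos (θ + θ ^ 2)) := by
  set α := θ + θ ^ 2 with hα
  have hα0 : 0 < α := by positivity
  have hα1 : α ≤ 11 / 100 := by nlinarith
  have hpi := pi_gt_three
  have hs1 : sin α ≤ α := sin_le hα0.le
  have hs0 : 0 < sin α := sin_pos_of_pos_of_lt_pi hα0 (by linarith)
  have hcα := cos_bound (x := α) (by rw [abs_of_pos hα0]; linarith)
  rw [abs_of_pos hα0] at hcα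
  have hcα' := (abs_le.1 hcα).2
  have hcθ := one_sub_sq_div_two_le_cos (x := θ)
  set u := 1 - cos α with hu
  set v := 1 - cos θ with hv
  have hv1 : v ≤ θ ^ 2 / 2 := by rw [hv]; linarith
  have hv0 : 0 ≤ v := by rw [hv]; linarith [cos_le_one θ]
  have hu1 : α ^ 2 / 2 * (1 - 5 / 48 * α ^ 2) ≤ u := by rw [hu]; nlinarith
  have hu0 : 0 ≤ u := by rw [hu]; linarith [cos_le_one α]
  -- goal: v * (π - α + s (1-u)) < u (π - α - s)
  suffices h : v * (π - α + sin α * cos α) < u * (π - α - sin α) by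
    have e1 : cos α = 1 - u := by rw [hu]; ring
    have e2 : cos θ = 1 - v := by rw [hv]; ring
    rw [e1] at h ⊢
    rw [e2]
    nlinarith
  have hA : π - α + sin α * cos α ≤ π := by
    have : sin α * cos α ≤ sin α := by nlinarith [cos_le_one α]
    linarith
  have hB : π - 2 * α ≤ π - α - sin α := by linarith
  have hαe : α ^ 2 = θ ^ 2 * (1 + θ) ^ 2 := by rw [hα]; ring
  have step : θ ^ 2 / 2 * π < α ^ 2 / 2 * (1 - 5 / 48 * α ^ 2) * (π - 2 * α) := by
    rw [hαe]
    have hθ2 : 0 < θ ^ 2 / 2 := by positivity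
    have main : π < (1 + θ) ^ 2 * (1 - 5 / 48 * (θ ^ 2 * (1 + θ) ^ 2)) * (π - 2 * α) := by
      have k1 : (1 + θ) ^ 2 ≤ 121 / 100 := by nlinarith
      have k2 : 5 / 48 * (θ ^ 2 * (1 + θ) ^ 2) ≤ θ / 50 := by
        have : θ ^ 2 * (1 + θ) ^ 2 ≤ θ ^ 2 * (121 / 100) := by gcongr
        nlinarith
      have k3 : 1 + 19 / 10 * θ ≤ (1 + θ) ^ 2 * (1 - 5 / 48 * (θ ^ 2 * (1 + θ) ^ 2)) := by
        have : (1 + θ) ^ 2 * (1 - θ / 50) ≤ (1 + θ) ^ 2 * (1 - 5 / 48 * (θ ^ 2 * (1 + θ) ^ 2)) := by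
          gcongr
        nlinarith
      have k4 : 0 < π - 2 * α := by linarith
      have k5 : (1 + 19 / 10 * θ) * (π - 2 * α)
          ≤ (1 + θ) ^ 2 * (1 - 5 / 48 * (θ ^ 2 * (1 + θ) ^ 2)) * (π - 2 * α) := by gcongr
      have k6 : π < (1 + 19 / 10 * θ) * (π - 2 * α) := by
        have : α ≤ 11 / 10 * θ := by rw [hα]; nlinarith
        nlinarith
      linarith
    calc θ ^ 2 / 2 * π < θ ^ 2 / 2 * ((1 + θ) ^ 2 * (1 - 5 / 48 * (θ ^ 2 * (1 + θ) ^ 2)) * (π - 2 * α)) := by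
          gcongr
      _ = _ := by ring
  calc v * (π - α + sin α * cos α) ≤ v * π := by gcongr
    _ ≤ θ ^ 2 / 2 * π := by gcongr
    _ < α ^ 2 / 2 * (1 - 5 / 48 * α ^ 2) * (π - 2 * α) := step
    _ ≤ u * (π - 2 * α) := by
        have : 0 ≤ π - 2 * α := by linarith
        gcongr
    _ ≤ _ := by gcongr

theorem hypercube_lsh_exponent_near_parallel
    (μ : (d : ℕ) → Measure (Matrix.orthogonalGroup (Fin d) ℝ))
    (hHaar : ∀ d, (μ d).IsHaarMeasure)
    (hProb : ∀ d, IsProbabilityMeasure (μ d))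
    (L : ℝ → ℝ)
    (hL : ∀ θ ∈ Set.Ioo (0 : ℝ) (π / 2),
      Tendsto (fun d : ℕ => (1 / (d : ℝ)) * Real.log (collProb d θ (μ d))) atTop
        (nhds (L θ))) :
    ∃ C > (0 : ℝ), ∃ ε₀ > (0 : ℝ), ∀ ε ∈ Set.Ioo (0 : ℝ) ε₀,
      |L (Real.arccos (1 - ε)) + (Real.sqrt 2 / π) * Real.sqrt ε| ≤ C * ε := by
  refine ⟨20, by norm_num, 1 / 1000, by norm_num, ?_⟩
  rintro ε ⟨he0, he1⟩
  set θ := Real.arccos (1 - ε) with hθ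
  have hpi := pi_gt_three
  have hpi4 := pi_lt_d2
  have hcos : cos θ = 1 - ε := Real.cos_arccos (by linarith) (by linarith)
  have hθ0 : 0 < θ := Real.arccos_pos.2 (by linarith)
  have hθpi : θ ≤ π := Real.arccos_le_pi _
  have hq := Real.cos_le_one_sub_mul_cos_sq (x := θ) (by rw [abs_of_pos hθ0]; exact hθpi)
  have hθ2 : θ ^ 2 ≤ 5 * ε := by
    rw [hcos] at hq
    have h1 : 2 / π ^ 2 * θ ^ 2 ≤ ε := by linarith
    have h2 : (1:ℝ) / 5 ≤ 2 / π ^ 2 := by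
      rw [div_le_div_iff₀ (by norm_num) (by positivity)]; nlinarith
    nlinarith [sq_nonneg θ]
  have hθ1 : θ ≤ 1 / 10 := by nlinarith
  set α₁ := θ + θ ^ 2 with hα₁
  set α₂ := θ - θ ^ 2 with hα₂
  have hα₂0 : 0 < α₂ := by rw [hα₂]; nlinarith
  have hα₁b : α₁ ≤ 11 / 10 * θ := by rw [hα₁]; nlinarith
  have hlow := lower_bd μ hHaar hProb α₁ θ (by positivity) (by linarith) hθ0 (by linarith)
    (trig_ineq θ hθ0 hθ1)
  have hup := upper_bd μ hHaar hProb α₂ θ hα₂0 (by rw [hα₂]; nlinarith) (by linarith)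
  have hα₁θ : α₁ / π ≤ θ := by
    rw [div_le_iff₀ (by linarith)]; nlinarith
  have hα₁0 : 0 ≤ α₁ / π := by positivity
  have hα₂θ : α₂ / π ≤ θ := by
    rw [div_le_iff₀ (by linarith)]; nlinarith
  obtain ⟨hl, hu⟩ := squeeze _ (L θ) (1 - α₁ / π) (1 - α₂ / π) (by linarith) (by linarith)
    (hL θ ⟨hθ0, by linarith⟩) hlow hup
  have hu' : L θ ≤ - (α₂ / π) := by
    have := Real.log_le_sub_one_of_pos (x := 1 - α₂ / π) (by linarith)
    linarith
  have hl' : - (α₁ / π) - 2 * θ ^ 2 ≤ L θ := by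
    have h1 := Real.one_sub_inv_le_log_of_pos (x := 1 - α₁ / π) (by linarith)
    set t := α₁ / π with ht
    have h2 : (1 - t)⁻¹ ≤ 1 + t + 2 * θ ^ 2 := by
      rw [inv_le_iff_one_le_mul₀ (by linarith)]
      nlinarith [mul_nonneg hα₁0 (sub_nonneg.2 hα₁θ)]
    linarith
  have e1 : α₁ / π = θ / π + θ ^ 2 / π := by rw [hα₁]; ring
  have e2 : α₂ / π = θ / π - θ ^ 2 / π := by rw [hα₂]; ring
  have e3 : θ ^ 2 / π ≤ θ ^ 2 := div_le_self (by positivity) (by linarith)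
  have hsq : √2 / π * √ε = √(2 * ε) / π := by
    rw [Real.sqrt_mul (by norm_num)]; ring
  have hs1 : √(2 * ε) ≤ θ := by
    rw [Real.sqrt_le_left hθ0.le]
    have := one_sub_sq_div_two_le_cos (x := θ)
    rw [hcos] at this; linarith
  have hs2 : θ - θ ^ 2 ≤ √(2 * ε) := by
    apply Real.le_sqrt_of_sq_le
    have h := (abs_le.1 (cos_bound (x := θ) (by rw [abs_of_pos hθ0]; linarith))).2
    rw [hcos, abs_of_pos hθ0] at h
    have h3 : θ ^ 4 ≤ θ ^ 3 := by nlinarith [pow_pos hθ0 3]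
    nlinarith [pow_pos hθ0 3]
  have e4 : √(2 * ε) / π ≤ θ / π := by gcongr
  have e5 : θ / π - θ ^ 2 / π ≤ √(2 * ε) / π := by
    rw [← sub_div]; gcongr
  rw [hsq, abs_le]
  constructor
  · linarith
  · linarith
end
end
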